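/- arXiv:1210.8284 — 2 statements merged into one kernel-verified Lean document; each statement's English description precedes it below -/
import Mathlib

section
/- Let p ∈ (2,∞) with conjugate q = p/(p−1) ∈ (1,2), and let μ_p be the probability measure on ℝ with density t ↦ p·exp(−|t|^p)/(2·Γ(1/p)) with respect to Lebesgue measure. Let ξ = (ξ_1,…,ξ_n) have i.i.d. coordinates distributed according to μ_p, and set δ_1 = E[ξ_1^2]/(160·2^{2/q}). Then for every integer n ≥ 41 and every w ∈ ℝ^n, Pr( ⟨w,ξ⟩/‖ξ‖_p ≥ √(δ_1·(log n)/n) · ‖w‖_q ) ≥ (1/144) · n^{−1/40}. -/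
open MeasureTheory
open scoped ENNReal

section ProductMeasures

variable {ι : Type*} [Fintype ι] {ν : Measure ℝ}

open ProbabilityTheory in
theorem pi_withDensity_eq [IsProbabilityMeasure ν] {g : ι → ℝ → ℝ≥0∞}
    (hg : ∀ i, Measurable (g i)) [∀ i, SigmaFinite (ν.withDensity (g i))] :
    Measure.pi (fun i => ν.withDensity (g i)) =
      (Measure.pi fun _ : ι => ν).withDensity (fun x => ∏ i, g i (x i)) := by
  refine Measure.pi_eq fun s hs => ?_
  rw [withDensity_apply _ (MeasurableSet.univ_pi hs), ← lintegral_indicator (MeasurableSet.univ_pi hs)]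
  have h1 : ∀ x : ι → ℝ, (Set.univ.pi s).indicator (fun x => ∏ i, g i (x i)) x =
      ∏ i, (s i).indicator (g i) (x i) := by
    intro x
    by_cases hx : x ∈ Set.univ.pi s
    · rw [Set.indicator_of_mem hx]
      exact Finset.prod_congr rfl fun i _ =>
        (Set.indicator_of_mem (hx i (Set.mem_univ i)) _).symm
    · rw [Set.indicator_of_notMem hx]
      simp only [Set.mem_pi, Set.mem_univ, true_imp_iff, not_forall] at hx
      obtain ⟨i, hi⟩ := hx
      exact (Finset.prod_eq_zero (Finset.mem_univ i) (Set.indicator_of_notMem hi _)).symm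
  simp_rw [h1]
  have hm : ∀ i, Measurable ((s i).indicator (g i)) := fun i => (hg i).indicator (hs i)
  rw [lintegral_prod_eq_prod_lintegral_of_indepFun Finset.univ
    (fun i (x : ι → ℝ) => (s i).indicator (g i) (x i))
    (iIndepFun_pi (μ := fun _ => ν) fun i => (hm i).aemeasurable)
    fun i => (hm i).comp (measurable_pi_apply i)]
  refine Finset.prod_congr rfl fun i _ => ?_
  rw [withDensity_apply _ (hs i), ← lintegral_indicator (hs i),
    ← (measurePreserving_eval (fun _ : ι => ν) i).lintegral_comp (hm i)]

theorem le_pi_of_transport [IsProbabilityMeasure ν] {g : ι → ℝ → ℝ} {T : ι → ℝ → ℝ}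
    (hg : ∀ i, Measurable (g i)) (hT : ∀ i, Measurable (T i))
    (h0 : ∀ i x, 0 ≤ g i x)
    (hmap : ∀ i, (ν.withDensity fun x => ENNReal.ofReal (g i x)).map (T i) = ν)
    {A E : Set (ι → ℝ)} (hA : MeasurableSet A) {c : ℝ}
    (hEA : ∀ x ∈ E, (fun i => T i (x i)) ∈ A)
    (hEg : ∀ x ∈ E, Real.exp (-c) ≤ ∏ i, g i (x i)) :
    Real.exp (-c) * (Measure.pi fun _ : ι => ν).real E ≤ (Measure.pi fun _ : ι => ν).real A := by
  have hg' : ∀ i, Measurable fun x => ENNReal.ofReal (g i x) := fun i => (hg i).ennreal_ofReal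
  have hp : ∀ i, IsProbabilityMeasure (ν.withDensity fun x => ENNReal.ofReal (g i x)) := by
    intro i
    refine ⟨?_⟩
    have := congrArg (fun m : Measure ℝ => m Set.univ) (hmap i)
    simpa [Measure.map_apply (hT i) MeasurableSet.univ] using this
  have hsf : ∀ i, SigmaFinite ((ν.withDensity fun x => ENNReal.ofReal (g i x)).map (T i)) := by
    intro i; rw [hmap i]; infer_instance
  have hΦ : Measurable fun (x : ι → ℝ) i => T i (x i) :=
    measurable_pi_lambda _ fun i => (hT i).comp (measurable_pi_apply i)
  have key : (Measure.pi fun _ : ι => ν) A =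
      ∫⁻ x in (fun (x : ι → ℝ) i => T i (x i)) ⁻¹' A,
        ∏ i, ENNReal.ofReal (g i (x i)) ∂(Measure.pi fun _ : ι => ν) := by
    rw [← withDensity_apply _ (hΦ hA), ← pi_withDensity_eq (ν := ν) hg',
      ← Measure.map_apply hΦ hA,
      Measure.pi_map_pi (μ := fun i => ν.withDensity fun x => ENNReal.ofReal (g i x))
        fun i => (hT i).aemeasurable]
    simp_rw [hmap]
  have hmain : ENNReal.ofReal (Real.exp (-c)) * (Measure.pi fun _ : ι => ν) E ≤
      (Measure.pi fun _ : ι => ν) A := by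
    set H : Set (ι → ℝ) := (fun (x : ι → ℝ) i => T i (x i)) ⁻¹' A ∩
      {x | ENNReal.ofReal (Real.exp (-c)) ≤ ∏ i, ENNReal.ofReal (g i (x i))} with hH
    have hHm : MeasurableSet {x : ι → ℝ | ENNReal.ofReal (Real.exp (-c)) ≤
        ∏ i, ENNReal.ofReal (g i (x i))} := by
      refine measurableSet_le measurable_const ?_
      exact Finset.measurable_prod _ fun i _ => (hg' i).comp (measurable_pi_apply i)
    have hsub : E ⊆ H := by
      intro x hx
      refine ⟨hEA x hx, ?_⟩
      rw [Set.mem_ofPred_eq, ← ENNReal.ofReal_prod_of_nonneg fun i _ => h0 i _]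
      exact ENNReal.ofReal_le_ofReal (hEg x hx)
    calc _ ≤ ENNReal.ofReal (Real.exp (-c)) * (Measure.pi fun _ : ι => ν) H := by gcongr
      _ = ∫⁻ x in H, ENNReal.ofReal (Real.exp (-c)) ∂(Measure.pi fun _ : ι => ν) := by simp
      _ ≤ ∫⁻ x in H, ∏ i, ENNReal.ofReal (g i (x i)) ∂(Measure.pi fun _ : ι => ν) :=
        setLIntegral_mono' ((hΦ hA).inter hHm) fun x hx => hx.2
      _ ≤ _ := by
        rw [key]
        exact lintegral_mono_set Set.inter_subset_left
  have := ENNReal.toReal_mono (measure_ne_top _ A) hmain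
  rwa [ENNReal.toReal_mul, ENNReal.toReal_ofReal (Real.exp_nonneg _)] at this

theorem half_le_measureReal_inter_nonneg {Ω : Type*} [MeasurableSpace Ω] {P : Measure Ω}
    [IsFiniteMeasure P] {σ : Ω → Ω} (hσ : MeasurePreserving σ P P) {S : Set Ω}
    (hS : MeasurableSet S) (hσS : σ ⁻¹' S = S) {X : Ω → ℝ} (hX : Measurable X)
    (hodd : ∀ x ∈ S, X (σ x) = -X x) :
    1 / 2 * P.real S ≤ P.real (S ∩ {x | 0 ≤ X x}) := by
  have hm : MeasurableSet (S ∩ {x | 0 ≤ X x}) := hS.inter (measurableSet_le measurable_const hX)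
  have h1 : P.real (σ ⁻¹' (S ∩ {x | 0 ≤ X x})) = P.real (S ∩ {x | 0 ≤ X x}) := by
    rw [measureReal_def, measureReal_def, hσ.measure_preimage hm.nullMeasurableSet]
  have h2 : S ⊆ (S ∩ {x | 0 ≤ X x}) ∪ σ ⁻¹' (S ∩ {x | 0 ≤ X x}) := by
    intro x hx
    rcases le_total 0 (X x) with h | h
    · exact Or.inl ⟨hx, h⟩
    · refine Or.inr ⟨?_, ?_⟩
      · rw [← Set.mem_preimage, hσS]; exact hx
      · simp only [Set.mem_ofPred_eq, hodd x hx]; linarith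
  have h3 := (measureReal_mono (μ := P) h2).trans (measureReal_union_le _ _)
  rw [h1] at h3
  linarith

theorem measureReal_sum_ge_le_of_mean [IsProbabilityMeasure ν] {f : ι → ℝ → ℝ}
    (hf : ∀ i, MemLp (f i) 2 ν) {a v c : ℝ} (ha : ∑ i, ∫ x, f i x ∂ν ≤ a)
    (hv : ∑ i, ∫ x, f i x ^ 2 ∂ν ≤ v) (hc : 0 < c) :
    (Measure.pi fun _ : ι => ν).real {x | a + c ≤ ∑ i, f i (x i)} ≤ v / c ^ 2 := by
  have hmem : ∀ i, MemLp (fun x : ι → ℝ => f i (x i)) 2 (Measure.pi fun _ : ι => ν) := fun i =>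
    (hf i).comp_measurePreserving (measurePreserving_eval (fun _ : ι => ν) i)
  have hsum : MemLp (fun x : ι → ℝ => ∑ i, f i (x i)) 2 (Measure.pi fun _ : ι => ν) :=
    memLp_finsetSum _ fun i _ => hmem i
  have hint : ∫ x : ι → ℝ, ∑ i, f i (x i) ∂(Measure.pi fun _ : ι => ν) = ∑ i, ∫ x, f i x ∂ν := by
    rw [integral_finsetSum _ fun i _ => (hmem i).integrable (by norm_num)]
    refine Finset.sum_congr rfl fun i _ => ?_
    exact integral_comp_eval (μ := fun _ : ι => ν) (hf i).1
  have hvar : ProbabilityTheory.variance (fun x : ι → ℝ => ∑ i, f i (x i))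
      (Measure.pi fun _ : ι => ν) ≤ v := by
    have h1 := ProbabilityTheory.variance_sum_pi (μ := fun _ : ι => ν) (X := f) hf
    have h2 : (∑ i, fun x : ι → ℝ => f i (x i)) = fun x => ∑ i, f i (x i) := by
      ext x; simp
    rw [h2] at h1
    rw [h1]
    refine le_trans (Finset.sum_le_sum fun i _ => ?_) hv
    exact ProbabilityTheory.variance_le_expectation_sq (hf i).1
  have hcheb := ProbabilityTheory.meas_ge_le_variance_div_sq hsum hc
  rw [hint] at hcheb
  have hsub : {x : ι → ℝ | a + c ≤ ∑ i, f i (x i)} ⊆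
      {x | c ≤ |∑ i, f i (x i) - ∑ i, ∫ x, f i x ∂ν|} := by
    intro x hx
    simp only [Set.mem_ofPred_eq] at hx ⊢
    exact le_trans (by linarith) (le_abs_self _)
  have h3 := ENNReal.toReal_mono ENNReal.ofReal_ne_top ((measure_mono hsub).trans hcheb)
  rw [ENNReal.toReal_ofReal (div_nonneg (ProbabilityTheory.variance_nonneg _ _) (sq_nonneg _))] at h3
  refine h3.trans ?_
  gcongr

theorem measureReal_abs_sum_ge_le_of_mean_zero [IsProbabilityMeasure ν] {f : ι → ℝ → ℝ}
    (hf : ∀ i, MemLp (f i) 2 ν) {v c : ℝ} (ha : ∀ i, ∫ x, f i x ∂ν = 0)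
    (hv : ∑ i, ∫ x, f i x ^ 2 ∂ν ≤ v) (hc : 0 < c) :
    (Measure.pi fun _ : ι => ν).real {x | c ≤ |∑ i, f i (x i)|} ≤ v / c ^ 2 := by
  have hmem : ∀ i, MemLp (fun x : ι → ℝ => f i (x i)) 2 (Measure.pi fun _ : ι => ν) := fun i =>
    (hf i).comp_measurePreserving (measurePreserving_eval (fun _ : ι => ν) i)
  have hsum : MemLp (fun x : ι → ℝ => ∑ i, f i (x i)) 2 (Measure.pi fun _ : ι => ν) :=
    memLp_finsetSum _ fun i _ => hmem i
  have hint : ∫ x : ι → ℝ, ∑ i, f i (x i) ∂(Measure.pi fun _ : ι => ν) = 0 := by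
    rw [integral_finsetSum _ fun i _ => (hmem i).integrable (by norm_num)]
    refine Finset.sum_eq_zero fun i _ => ?_
    rw [integral_comp_eval (μ := fun _ : ι => ν) (hf i).1, ha]
  have hvar : ProbabilityTheory.variance (fun x : ι → ℝ => ∑ i, f i (x i))
      (Measure.pi fun _ : ι => ν) ≤ v := by
    have h1 := ProbabilityTheory.variance_sum_pi (μ := fun _ : ι => ν) (X := f) hf
    have h2 : (∑ i, fun x : ι → ℝ => f i (x i)) = fun x => ∑ i, f i (x i) := by
      ext x; simp
    rw [h2] at h1
    rw [h1]
    refine le_trans (Finset.sum_le_sum fun i _ => ?_) hv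
    exact ProbabilityTheory.variance_le_expectation_sq (hf i).1
  have hcheb := ProbabilityTheory.meas_ge_le_variance_div_sq hsum hc
  rw [hint] at hcheb
  simp only [sub_zero] at hcheb
  have h3 := ENNReal.toReal_mono ENNReal.ofReal_ne_top hcheb
  rw [ENNReal.toReal_ofReal (div_nonneg (ProbabilityTheory.variance_nonneg _ _) (sq_nonneg _))] at h3
  refine h3.trans ?_
  gcongr

theorem measureReal_sum_ge_le_of_nonneg [IsProbabilityMeasure ν] {f : ι → ℝ → ℝ}
    (hf : ∀ i, Integrable (f i) ν) (h0 : ∀ i x, 0 ≤ f i x) {a c : ℝ}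
    (ha : ∑ i, ∫ x, f i x ∂ν ≤ a) (hc : 0 < c) :
    (Measure.pi fun _ : ι => ν).real {x | c ≤ ∑ i, f i (x i)} ≤ a / c := by
  have hmem : ∀ i, Integrable (fun x : ι → ℝ => f i (x i)) (Measure.pi fun _ : ι => ν) := fun i =>
    integrable_comp_eval (μ := fun _ : ι => ν) (hf i)
  have h := mul_meas_ge_le_integral_of_nonneg (μ := Measure.pi fun _ : ι => ν)
    (f := fun x : ι → ℝ => ∑ i, f i (x i))
    (Filter.Eventually.of_forall fun x => Finset.sum_nonneg fun i _ => h0 i _)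
    (integrable_finsetSum _ fun i _ => hmem i) c
  rw [integral_finsetSum _ fun i _ => hmem i] at h
  rw [le_div_iff₀ hc, mul_comm]
  refine h.trans (le_trans (le_of_eq (Finset.sum_congr rfl fun i _ => ?_)) ha)
  exact integral_comp_eval (μ := fun _ : ι => ν) (hf i).1

end ProductMeasures

section ExpPow

/-- The probability measure on `ℝ` with density `t ↦ p * exp (-|t| ^ p) / (2 * Γ(1 / p))`. -/
noncomputable def expPowMeasure (p : ℝ) : Measure ℝ :=
  volume.withDensity fun t =>
    ENNReal.ofReal (p * Real.exp (-(|t| ^ p)) / (2 * Real.Gamma (1 / p)))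

variable {p : ℝ}

theorem measurable_expPow_density (p : ℝ) :
    Measurable fun t : ℝ => p * Real.exp (-(|t| ^ p)) / (2 * Real.Gamma (1 / p)) := by
  fun_prop

theorem expPow_density_nonneg (hp : 0 < p) (t : ℝ) :
    0 ≤ p * Real.exp (-(|t| ^ p)) / (2 * Real.Gamma (1 / p)) := by
  have : 0 < Real.Gamma (1 / p) := Real.Gamma_pos_of_pos (by positivity)
  positivity

theorem integrable_expPow_iff (hp : 0 < p) {f : ℝ → ℝ} :
    Integrable f (expPowMeasure p) ↔ Integrable fun t => f t * Real.exp (-(|t| ^ p)) := by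
  have hG : 0 < Real.Gamma (1 / p) := Real.Gamma_pos_of_pos (by positivity)
  rw [expPowMeasure, integrable_withDensity_iff (measurable_expPow_density p).ennreal_ofReal
    (Filter.Eventually.of_forall fun _ => ENNReal.ofReal_lt_top)]
  have hc : IsUnit (p / (2 * Real.Gamma (1 / p))) := (by positivity : _ ≠ (0 : ℝ)).isUnit
  rw [← integrable_const_mul_iff hc (fun t => f t * Real.exp (-(|t| ^ p)))]
  refine integrable_congr (Filter.Eventually.of_forall fun t => ?_)
  simp only
  rw [ENNReal.toReal_ofReal (expPow_density_nonneg hp t)]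
  ring

theorem integral_expPow (hp : 0 < p) (f : ℝ → ℝ) :
    ∫ t, f t ∂(expPowMeasure p) =
      p / (2 * Real.Gamma (1 / p)) * ∫ t, f t * Real.exp (-(|t| ^ p)) := by
  rw [expPowMeasure, integral_withDensity_eq_integral_toReal_smul
    (measurable_expPow_density p).ennreal_ofReal
    (Filter.Eventually.of_forall fun _ => ENNReal.ofReal_lt_top), ← integral_const_mul]
  refine integral_congr_ae (Filter.Eventually.of_forall fun t => ?_)
  simp only
  rw [ENNReal.toReal_ofReal (expPow_density_nonneg hp t), smul_eq_mul]
  ring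

theorem integrable_abs_rpow_expPow (hp : 0 < p) {s : ℝ} (hs : -1 < s) :
    Integrable (fun t => |t| ^ s) (expPowMeasure p) := by
  rw [integrable_expPow_iff hp]
  have hf : IntegrableOn (fun t : ℝ => |t| ^ s * Real.exp (-(|t| ^ p))) (Set.Ioi 0) := by
    refine (integrableOn_rpow_mul_exp_neg_rpow hs hp).congr_fun (fun t ht => ?_) measurableSet_Ioi
    simp only [abs_of_pos (Set.mem_Ioi.mp ht)]
  have int_Iic : IntegrableOn (fun t : ℝ => |t| ^ s * Real.exp (-(|t| ^ p))) (Set.Iic 0) := by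
    rw [← Measure.map_neg_eq_self (volume : Measure ℝ)]
    have m : MeasurableEmbedding fun x : ℝ => -x := (Homeomorph.neg ℝ).measurableEmbedding
    rw [m.integrableOn_map_iff]
    simp_rw [Function.comp_def, abs_neg, Set.neg_preimage, Set.neg_Iic, neg_zero]
    exact Iff.mpr integrableOn_Ici_iff_integrableOn_Ioi hf
  rw [← integrableOn_univ, ← Set.Iic_union_Ioi (a := (0 : ℝ))]
  exact int_Iic.union hf

theorem integral_abs_rpow_expPow (hp : 0 < p) {s : ℝ} (hs : -1 < s) :
    ∫ t, |t| ^ s ∂(expPowMeasure p) = Real.Gamma ((s + 1) / p) / Real.Gamma (1 / p) := by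
  have hG : 0 < Real.Gamma (1 / p) := Real.Gamma_pos_of_pos (by positivity)
  rw [integral_expPow hp, integral_comp_abs (f := fun t => t ^ s * Real.exp (-(t ^ p))),
    integral_rpow_mul_exp_neg_rpow hp hs]
  field_simp

theorem isProbabilityMeasure_expPow (hp : 0 < p) : IsProbabilityMeasure (expPowMeasure p) := by
  have hG : 0 < Real.Gamma (1 / p) := Real.Gamma_pos_of_pos (by positivity)
  have h1 := integral_abs_rpow_expPow hp (s := 0) (by norm_num)
  have h2 := integrable_abs_rpow_expPow hp (s := 0) (by norm_num)
  simp only [Real.rpow_zero, zero_add, div_self hG.ne'] at h1 h2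
  have : IsFiniteMeasure (expPowMeasure p) := by
    rcases integrable_const_iff.mp h2 with h | h
    · norm_num at h
    · exact h
  rw [integral_const, smul_eq_mul, mul_one] at h1
  exact ⟨(ENNReal.toReal_eq_one_iff _).mp h1⟩

theorem integral_abs_rpow_self_expPow (hp : 0 < p) :
    ∫ t, |t| ^ p ∂(expPowMeasure p) = 1 / p := by
  have hG : 0 < Real.Gamma (1 / p) := Real.Gamma_pos_of_pos (by positivity)
  rw [integral_abs_rpow_expPow hp (by linarith), show (p + 1) / p = 1 / p + 1 by field_simp; ring,
    Real.Gamma_add_one (by positivity)]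
  field_simp

theorem integral_abs_rpow_two_mul_expPow (hp : 0 < p) :
    ∫ t, |t| ^ (2 * p) ∂(expPowMeasure p) = (p + 1) / p ^ 2 := by
  have hG : 0 < Real.Gamma (1 / p) := Real.Gamma_pos_of_pos (by positivity)
  rw [integral_abs_rpow_expPow hp (by linarith),
    show (2 * p + 1) / p = 1 / p + 1 + 1 by field_simp; ring,
    Real.Gamma_add_one (by positivity), Real.Gamma_add_one (by positivity)]
  field_simp
  ring

theorem integral_abs_rpow_le_expPow (hp : 0 < p) {s : ℝ} (hs : 0 ≤ s) (hsp : s ≤ p) :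
    ∫ t, |t| ^ s ∂(expPowMeasure p) ≤ p ^ (-(s / p)) := by
  have := isProbabilityMeasure_expPow hp
  have hpt : ∀ t : ℝ, |t| ^ s ≤ p ^ (-(s / p)) * (s / p * (p * |t| ^ p) + (1 - s / p)) := by
    intro t
    have h := Real.geom_mean_le_arith_mean2_weighted (w₁ := s / p) (w₂ := 1 - s / p)
      (p₁ := p * |t| ^ p) (p₂ := 1) (by positivity)
      (by rw [sub_nonneg, div_le_one hp]; exact hsp) (by positivity) zero_le_one (by ring)
    rw [Real.one_rpow, mul_one, mul_one, Real.mul_rpow hp.le (by positivity),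
      ← Real.rpow_mul (abs_nonneg t), mul_div_cancel₀ _ hp.ne'] at h
    have hc : 0 < p ^ (s / p) := by positivity
    rw [Real.rpow_neg hp.le, inv_mul_eq_div, le_div_iff₀ hc]
    linarith
  have hi := integrable_abs_rpow_expPow hp (s := p) (by linarith)
  calc ∫ t, |t| ^ s ∂(expPowMeasure p)
      ≤ ∫ t, p ^ (-(s / p)) * (s / p * (p * |t| ^ p) + (1 - s / p)) ∂(expPowMeasure p) :=
        integral_mono (integrable_abs_rpow_expPow hp (by linarith))
          ((((hi.const_mul p).const_mul _).add (integrable_const _)).const_mul _) hpt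
    _ = p ^ (-(s / p)) := by
      rw [integral_const_mul, integral_add ((hi.const_mul p).const_mul _) (integrable_const _),
        integral_const_mul, integral_const_mul, integral_abs_rpow_self_expPow hp]
      simp
      field_simp
      simp

theorem integral_abs_rpow_le_one_expPow (hp : 1 ≤ p) {s : ℝ} (hs : 0 ≤ s) (hsp : s ≤ p) :
    ∫ t, |t| ^ s ∂(expPowMeasure p) ≤ 1 :=
  (integral_abs_rpow_le_expPow (by linarith) hs hsp).trans
    (Real.rpow_le_one_of_one_le_of_nonpos hp (by
      have : 0 ≤ s / p := by positivity
      linarith))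

theorem integral_abs_rpow_two_mul_sub_two_le_expPow (hp : 2 ≤ p) :
    ∫ t, |t| ^ (2 * p - 2) ∂(expPowMeasure p) ≤ (p - 1) / p := by
  have hp0 : 0 < p := by linarith
  have hG : 0 < Real.Gamma (1 / p) := Real.Gamma_pos_of_pos (by positivity)
  have h := integral_abs_rpow_le_one_expPow (p := p) (s := p - 2) (by linarith) (by linarith)
    (by linarith)
  rw [integral_abs_rpow_expPow hp0 (by linarith)] at h ⊢
  have hpos : 0 < (p - 2 + 1) / p := div_pos (by linarith) hp0
  rw [show (2 * p - 2 + 1) / p = (p - 2 + 1) / p + 1 by field_simp; ring,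
    Real.Gamma_add_one hpos.ne', mul_div_assoc]
  calc _ ≤ (p - 2 + 1) / p * 1 := by gcongr
    _ = _ := by ring

theorem measurePreserving_neg_expPow (p : ℝ) :
    MeasurePreserving (fun t : ℝ => -t) (expPowMeasure p) (expPowMeasure p) := by
  refine ⟨measurable_neg, ?_⟩
  ext s hs
  have hd := (measurable_expPow_density p).ennreal_ofReal
  rw [Measure.map_apply measurable_neg hs, expPowMeasure,
    withDensity_apply _ hs, withDensity_apply _ (measurable_neg hs)]
  have h := (Measure.measurePreserving_neg (volume : Measure ℝ)).setLIntegral_comp_preimage hs hd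
  simpa only [abs_neg] using h

theorem expPow_density_le (hp : 1 < p) (t : ℝ) :
    p * Real.exp (-(|t| ^ p)) / (2 * Real.Gamma (1 / p)) ≤ p ^ (1 / p) / 2 := by
  have hp0 : 0 < p := by linarith
  have hG : 0 < Real.Gamma (1 / p) := Real.Gamma_pos_of_pos (by positivity)
  have h1 := Real.Gamma_mul_add_mul_le_rpow_Gamma_mul_rpow_Gamma (s := 1 / p) (t := 1 / p + 1)
    (a := 1 / p) (b := 1 - 1 / p) (by positivity) (by positivity) (by positivity)
    (by rw [sub_pos, div_lt_one hp0]; exact hp) (by ring)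
  rw [show 1 / p * (1 / p) + (1 - 1 / p) * (1 / p + 1) = 1 by ring, Real.Gamma_one,
    Real.Gamma_add_one (by positivity)] at h1
  set γ := 1 / p * Real.Gamma (1 / p) with hγ
  have hγ0 : 0 < γ := by positivity
  have hΓ : Real.Gamma (1 / p) = p * γ := by rw [hγ]; field_simp
  rw [hΓ, Real.mul_rpow hp0.le hγ0.le, mul_assoc, ← Real.rpow_add hγ0,
    show 1 / p + (1 - 1 / p) = 1 by ring, Real.rpow_one] at h1
  rw [hΓ]
  have hexp : Real.exp (-(|t| ^ p)) ≤ 1 := Real.exp_le_one_iff.mpr (by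
    have : 0 ≤ |t| ^ p := by positivity
    linarith)
  rw [div_le_div_iff₀ (by positivity) two_pos]
  calc p * Real.exp (-(|t| ^ p)) * 2 ≤ p * 1 * 2 := by gcongr
    _ = 2 * p * 1 := by ring
    _ ≤ 2 * p * (p ^ (1 / p) * γ) := by gcongr
    _ = _ := by ring

end ExpPow

section PowerInequalities

theorem hasDerivAt_abs_rpow_mul_self {r : ℝ} (hr : 0 < r) (x : ℝ) :
    HasDerivAt (fun x : ℝ => |x| ^ r * x) ((r + 1) * |x| ^ r) x := by
  rcases eq_or_ne x 0 with rfl | hx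
  · rw [abs_zero, Real.zero_rpow hr.ne', mul_zero, hasDerivAt_iff_tendsto_slope_zero]
    have hc : Filter.Tendsto (fun t : ℝ => |t| ^ r) (nhdsWithin 0 {0}ᶜ) (nhds 0) := by
      have : ContinuousAt (fun t : ℝ => |t| ^ r) 0 :=
        continuous_abs.continuousAt.rpow_const (Or.inr hr.le)
      have h := this.tendsto
      simp only [abs_zero, Real.zero_rpow hr.ne'] at h
      exact h.mono_left nhdsWithin_le_nhds
    refine hc.congr' ?_
    filter_upwards [self_mem_nhdsWithin] with t ht
    have ht' : t ≠ 0 := ht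
    simp only [zero_add, mul_zero, sub_zero, smul_eq_mul]
    field_simp
  · have h := ((hasDerivAt_abs hx).rpow_const (p := r) (Or.inl (abs_ne_zero.mpr hx))).mul
      (hasDerivAt_id x)
    refine h.congr_deriv ?_
    have h1 : |x| ^ (r - 1) * |x| = |x| ^ r := by
      rw [Real.rpow_sub_one (abs_ne_zero.mpr hx), div_mul_cancel₀ _ (abs_ne_zero.mpr hx)]
    have h2 : (SignType.sign x : ℝ) * x = |x| := sign_mul_self x
    simp only [id, mul_one]
    calc (SignType.sign x : ℝ) * r * |x| ^ (r - 1) * x + |x| ^ r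
        = r * (|x| ^ (r - 1) * ((SignType.sign x : ℝ) * x)) + |x| ^ r := by ring
      _ = _ := by rw [h2, h1]; ring

theorem abs_rpow_mul_self_sub_le {r : ℝ} (hr : 0 < r) (hr1 : r ≤ 1) (a y : ℝ) :
    |(|a + y| ^ r * (a + y)) - |a| ^ r * a| ≤ (r + 1) * (|a| ^ r + |y| ^ r) * |y| := by
  have h := Convex.norm_image_sub_le_of_norm_hasDerivWithin_le (s := segment ℝ a (a + y))
    (f := fun x : ℝ => |x| ^ r * x) (f' := fun x => (r + 1) * |x| ^ r)
    (C := (r + 1) * (|a| ^ r + |y| ^ r)) (x := a) (y := a + y)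
    (fun x _ => (hasDerivAt_abs_rpow_mul_self hr x).hasDerivWithinAt)
    (fun x hx => by
      obtain ⟨θ, hθ, rfl⟩ := (segment_eq_image' ℝ a (a + y)) ▸ hx
      simp only [add_sub_cancel_left, smul_eq_mul]
      rw [Real.norm_of_nonneg (by positivity)]
      have h1 : |a + θ * y| ≤ |a| + |y| := by
        refine (abs_add_le _ _).trans ?_
        rw [abs_mul, abs_of_nonneg hθ.1]
        have := mul_le_mul_of_nonneg_right hθ.2 (abs_nonneg y)
        linarith
      have h2 : |a + θ * y| ^ r ≤ |a| ^ r + |y| ^ r :=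
        (Real.rpow_le_rpow (abs_nonneg _) h1 hr.le).trans
          (Real.rpow_add_le_add_rpow (abs_nonneg _) (abs_nonneg _) hr.le hr1)
      gcongr)
    (convex_segment _ _) (left_mem_segment _ _ _) (right_mem_segment _ _ _)
  simpa [Real.norm_eq_abs] using h

theorem abs_add_rpow_le_taylor {p : ℝ} (hp : 2 < p) (hp3 : p ≤ 3) (a h : ℝ) :
    |a + h| ^ p - |a| ^ p - p * |a| ^ (p - 2) * a * h ≤
      p * (p - 1) / 2 * (h ^ 2 * |a| ^ (p - 2) + |h| ^ p) := by
  set D : ℝ → ℝ := fun s => p * (p - 1) / 2 * (s ^ 2 * (h ^ 2 * |a| ^ (p - 2)) + s ^ p * |h| ^ p)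
    + p * |a| ^ (p - 2) * a * h * s - |a + s * h| ^ p with hD
  have hder : ∀ s : ℝ, HasDerivAt D (p * (p - 1) / 2 * (2 * s * (h ^ 2 * |a| ^ (p - 2)) +
      p * s ^ (p - 1) * |h| ^ p) + p * |a| ^ (p - 2) * a * h -
      p * |a + s * h| ^ (p - 2) * (a + s * h) * h) s := by
    intro s
    have h1 : HasDerivAt (fun s : ℝ => s ^ 2) (2 * s) s := by
      simpa using hasDerivAt_pow 2 s
    have h2 : HasDerivAt (fun s : ℝ => s ^ p) (p * s ^ (p - 1)) s :=
      Real.hasDerivAt_rpow_const (Or.inr (by linarith))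
    have h3 : HasDerivAt (fun s : ℝ => a + s * h) h s := by
      simpa using ((hasDerivAt_id s).mul_const h).const_add a
    have h4 := (hasDerivAt_abs_rpow (a + s * h) (p := p) (by linarith)).comp s h3
    have h5 := ((((h1.mul_const (h ^ 2 * |a| ^ (p - 2))).add (h2.mul_const (|h| ^ p))).const_mul
      (p * (p - 1) / 2)).add ((hasDerivAt_id s).const_mul (p * |a| ^ (p - 2) * a * h))).sub h4
    refine h5.congr_deriv ?_
    ring
  have hmono : MonotoneOn D (Set.Icc 0 1) := by
    refine monotoneOn_of_deriv_nonneg (convex_Icc 0 1)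
      (fun s _ => (hder s).continuousAt.continuousWithinAt)
      (fun s _ => (hder s).differentiableAt.differentiableWithinAt) fun s hs => ?_
    rw [interior_Icc] at hs
    rw [(hder s).deriv]
    have hs0 := hs.1
    have hL := abs_rpow_mul_self_sub_le (r := p - 2) (by linarith) (by linarith) a (s * h)
    have h6 : ((|a + s * h| ^ (p - 2) * (a + s * h)) - |a| ^ (p - 2) * a) * h ≤
        (p - 1) * (|a| ^ (p - 2) + |s * h| ^ (p - 2)) * |s * h| * |h| := by
      refine (le_abs_self _).trans ?_
      rw [abs_mul]
      have : p - 2 + 1 = p - 1 := by ring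
      rw [this] at hL
      gcongr
    have h7 : |s * h| ^ (p - 2) * |s * h| * |h| = s ^ (p - 1) * |h| ^ p := by
      rw [abs_mul, abs_of_pos hs0, Real.mul_rpow hs0.le (abs_nonneg _)]
      have e1 : s ^ (p - 1) = s ^ (p - 2) * s := by
        rw [← Real.rpow_add_one hs0.ne']; congr 1; ring
      rcases eq_or_ne h 0 with rfl | hh
      · simp [Real.zero_rpow (by linarith : p ≠ 0)]
      have e2 : |h| ^ p = |h| ^ (p - 2) * |h| * |h| := by
        rw [← Real.rpow_add_one (abs_ne_zero.mpr hh), ← Real.rpow_add_one (abs_ne_zero.mpr hh)]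
        congr 1; ring
      rw [e1, e2]; ring
    have h8 : |s * h| * |h| = s * h ^ 2 := by
      rw [abs_mul, abs_of_pos hs0, mul_assoc, abs_mul_abs_self]; ring
    have h9 : 0 ≤ s ^ (p - 1) * |h| ^ p := by positivity
    have h10 : (p - 1) * (|a| ^ (p - 2) + |s * h| ^ (p - 2)) * |s * h| * |h| =
        (p - 1) * (s * (h ^ 2 * |a| ^ (p - 2)) + s ^ (p - 1) * |h| ^ p) := by
      rw [← h7]
      calc _ = (p - 1) * (|a| ^ (p - 2) * (|s * h| * |h|) +
          |s * h| ^ (p - 2) * |s * h| * |h|) := by ring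
        _ = _ := by rw [h8]; ring
    rw [h10] at h6
    have h11 : 0 ≤ p * ((p - 1) * (s * (h ^ 2 * |a| ^ (p - 2)) + s ^ (p - 1) * |h| ^ p) -
        ((|a + s * h| ^ (p - 2) * (a + s * h)) - |a| ^ (p - 2) * a) * h) :=
      mul_nonneg (by linarith) (by linarith)
    have h12 : 0 ≤ p * (p - 1) * (p / 2 - 1) * (s ^ (p - 1) * |h| ^ p) := by
      have : 0 ≤ p * (p - 1) * (p / 2 - 1) := by
        refine mul_nonneg (mul_nonneg ?_ ?_) ?_ <;> linarith
      positivity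
    linarith
  have h0 := hmono (Set.left_mem_Icc.mpr zero_le_one) (Set.right_mem_Icc.mpr zero_le_one)
    zero_le_one
  simp only [hD, ne_eq, OfNat.ofNat_ne_zero, not_false_eq_true, zero_pow, zero_mul,
    Real.zero_rpow (by linarith : p ≠ 0), add_zero, mul_zero, one_pow, Real.one_rpow, one_mul,
    mul_one] at h0
  linarith

theorem sum_sq_le_of_sum_abs_rpow_le {ι : Type*} [Fintype ι] {p : ℝ} (hp : 2 ≤ p) {b : ι → ℝ}
    (hb : ∑ i, |b i| ^ p ≤ 1) : ∑ i, b i ^ 2 ≤ (Fintype.card ι : ℝ) ^ (1 - 2 / p) := by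
  have hp0 : 0 < p := by linarith
  have h := Real.rpow_sum_le_const_mul_sum_rpow_of_nonneg Finset.univ (f := fun i => b i ^ 2)
    (p := p / 2) (by linarith) (fun i _ => sq_nonneg _)
  have h1 : ∀ i, (b i ^ 2) ^ (p / 2) = |b i| ^ p := by
    intro i
    rw [← sq_abs, ← Real.rpow_natCast, ← Real.rpow_mul (abs_nonneg _)]
    congr 1; push_cast; ring
  simp only [h1, Finset.card_univ] at h
  have hs : 0 ≤ ∑ i, b i ^ 2 := Finset.sum_nonneg fun i _ => sq_nonneg _
  have h2 : (∑ i, b i ^ 2) ^ (p / 2) ≤ (Fintype.card ι : ℝ) ^ (p / 2 - 1) :=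
    h.trans (mul_le_of_le_one_right (by positivity) hb)
  have h3 := Real.rpow_le_rpow (by positivity) h2 (by positivity : 0 ≤ 2 / p)
  rw [← Real.rpow_mul hs, ← Real.rpow_mul (by positivity),
    show p / 2 * (2 / p) = 1 by field_simp, Real.rpow_one] at h3
  refine h3.trans (le_of_eq ?_)
  congr 1
  field_simp

theorem exists_lp_dual_vector {ι : Type*} [Fintype ι] {p q : ℝ} (hpq : p.HolderConjugate q)
    {w : ι → ℝ} (hw : w ≠ 0) :
    0 < (∑ i, |w i| ^ q) ^ (1 / q) ∧ ∃ b : ι → ℝ, (∑ i, |b i| ^ p = 1) ∧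
      ∀ i, w i * b i = (∑ i, |w i| ^ q) ^ (1 / q) * |b i| ^ p := by
  have hq : 0 < q := hpq.symm.pos
  have hq1 : 1 < q := hpq.symm.lt
  have hpos : 0 < ∑ i, |w i| ^ q := by
    obtain ⟨j, hj⟩ := Function.ne_iff.mp hw
    refine Finset.sum_pos' (fun i _ => by positivity) ⟨j, Finset.mem_univ _, ?_⟩
    have : 0 < |w j| := abs_pos.mpr hj
    positivity
  set W := (∑ i, |w i| ^ q) ^ (1 / q) with hW
  have hW0 : 0 < W := by positivity
  have hWq : W ^ q = ∑ i, |w i| ^ q := by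
    rw [hW, ← Real.rpow_mul hpos.le, one_div_mul_cancel hq.ne', Real.rpow_one]
  have hWW : W ^ (q - 1) * W = W ^ q := by
    rw [← Real.rpow_add_one hW0.ne']; congr 1; ring
  set b : ι → ℝ := fun i => SignType.sign (w i) * (|w i| / W) ^ (q - 1) with hb
  have hwb : ∀ i, w i * b i = |w i| ^ q / W ^ (q - 1) := by
    intro i
    rw [hb]
    simp only
    rw [← mul_assoc, self_mul_sign, Real.div_rpow (abs_nonneg _) hW0.le]
    rcases eq_or_ne (w i) 0 with h | h
    · simp [h, Real.zero_rpow hq.ne']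
    · have h' : |w i| ≠ 0 := abs_ne_zero.mpr h
      rw [← mul_div_assoc, mul_comm, ← Real.rpow_add_one h']
      congr 2; ring
  have hbp : ∀ i, |b i| ^ p = |w i| ^ q / W ^ q := by
    intro i
    rcases eq_or_ne (w i) 0 with h | h
    · simp [hb, h, Real.zero_rpow hq.ne', Real.zero_rpow hpq.ne_zero]
    · have hs : |(SignType.sign (w i) : ℝ)| = 1 := by
        rcases lt_or_gt_of_ne h with h | h <;> simp [h]
      rw [hb]
      simp only
      rw [abs_mul, hs, one_mul, abs_of_nonneg (by positivity), ← Real.rpow_mul (by positivity),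
        hpq.symm.sub_one_mul_conj, Real.div_rpow (abs_nonneg _) hW0.le]
  refine ⟨hW0, b, ?_, ?_⟩
  · simp_rw [hbp]
    rw [← Finset.sum_div, ← hWq, div_self (by positivity)]
  · intro i
    rw [hwb, hbp, ← hWW]
    field_simp

end PowerInequalities

section ShiftCase

variable {p : ℝ}

theorem map_add_withDensity_expPow (hp : 0 < p) (h : ℝ) :
    ((expPowMeasure p).withDensity fun x =>
      ENNReal.ofReal (Real.exp (-(|x + h| ^ p - |x| ^ p)))).map (fun x => x + h) =
      expPowMeasure p := by
  have hd := (measurable_expPow_density p).ennreal_ofReal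
  have hg : Measurable fun x : ℝ => ENNReal.ofReal (Real.exp (-(|x + h| ^ p - |x| ^ p))) := by
    fun_prop
  ext s hs
  rw [Measure.map_apply (measurable_add_const h) hs, expPowMeasure, ← withDensity_mul _ hd hg,
    withDensity_apply _ hs, withDensity_apply _ (measurable_add_const h hs)]
  have key := (measurePreserving_add_right (volume : Measure ℝ) h).setLIntegral_comp_preimage hs hd
  rw [← key]
  refine lintegral_congr fun x => ?_
  simp only [Pi.mul_apply]
  rw [← ENNReal.ofReal_mul (expPow_density_nonneg hp x)]
  congr 1
  rw [div_mul_eq_mul_div, mul_assoc, ← Real.exp_add]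
  congr 3
  ring

theorem sq_abs_rpow_mul_self (hp : 2 < p) (x : ℝ) :
    (|x| ^ (p - 2) * x) ^ 2 = |x| ^ (2 * p - 2) := by
  rcases eq_or_ne x 0 with rfl | hx
  · simp [Real.zero_rpow (by linarith : (2 * p - 2) ≠ 0)]
  · have h := abs_pos.mpr hx
    rw [mul_pow, ← sq_abs x, ← Real.rpow_natCast |x| 2, ← Real.rpow_natCast (|x| ^ (p - 2)) 2,
      ← Real.rpow_mul h.le, ← Real.rpow_add h]
    congr 1
    push_cast
    ring

theorem integral_eq_zero_of_odd {ν : Measure ℝ} {σ : ℝ → ℝ} (hσ : MeasurePreserving σ ν ν)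
    {f : ℝ → ℝ} (hf : AEStronglyMeasurable f ν) (hodd : ∀ x, f (σ x) = -f x) :
    ∫ x, f x ∂ν = 0 := by
  have h1 : ∫ x, f (σ x) ∂ν = ∫ x, f x ∂ν := by
    conv_rhs => rw [← hσ.map_eq]
    rw [integral_map hσ.measurable.aemeasurable (by rw [hσ.map_eq]; exact hf)]
  simp only [hodd, integral_neg] at h1
  linarith

theorem memLp_two_abs_rpow_expPow (hp : 0 < p) :
    MemLp (fun x : ℝ => |x| ^ p) 2 (expPowMeasure p) := by
  have hm : Measurable fun x : ℝ => |x| ^ p := measurable_id.abs.pow_const p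
  rw [memLp_two_iff_integrable_sq hm.aestronglyMeasurable]
  refine (integrable_abs_rpow_expPow hp (s := 2 * p) (by linarith)).congr
    (Filter.Eventually.of_forall fun x => ?_)
  simp only
  rw [mul_comm, Real.rpow_mul (abs_nonneg _)]
  norm_num

theorem shift_scale_bounds (hp : 2 < p) {n : ℕ} (hn : 41 ≤ n) {t R β : ℝ} (ht0 : 0 ≤ t)
    (ht : t ^ 2 = Real.log n * 2 ^ (2 / p) / (640 * n)) (hR : R = (1.1 * n) ^ (1 / p))
    (hβ : β = p ^ (-(1 / p)) * t * R) :
    β ^ 2 * (n : ℝ) ^ (1 - 2 / p) ≤ Real.log n / 580 ∧ |β| ^ p ≤ Real.log n / 580 := by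
  have hp0 : 0 < p := by linarith
  have hn0 : (41 : ℝ) ≤ n := by exact_mod_cast hn
  have hnpos : (0 : ℝ) < n := by linarith
  have hL0 : 0 < Real.log n := Real.log_pos (by linarith)
  have hLn : Real.log n ≤ n := (Real.log_le_sub_one_of_pos hnpos).trans (by linarith)
  have he1 : 2 / p ≤ 1 := (div_le_one hp0).mpr hp.le
  have he0 : 0 < 2 / p := by positivity
  have hR0 : 0 < R := by rw [hR]; positivity
  have hβ0 : 0 ≤ β := by rw [hβ]; positivity
  have h11 : (1.1 : ℝ) ^ (2 / p) ≤ 1.1 := by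
    calc (1.1 : ℝ) ^ (2 / p) ≤ 1.1 ^ (1 : ℝ) :=
          Real.rpow_le_rpow_of_exponent_le (by norm_num) he1
      _ = 1.1 := Real.rpow_one _
  constructor
  · have hR2 : R ^ 2 = 1.1 ^ (2 / p) * (n : ℝ) ^ (2 / p) := by
      rw [hR, ← Real.rpow_natCast, ← Real.rpow_mul (by positivity),
        ← Real.mul_rpow (by norm_num) hnpos.le]
      congr 1
      push_cast
      ring
    have hp2 : (p ^ (-(1 / p))) ^ 2 * 2 ^ (2 / p) = (2 / p) ^ (2 / p) := by
      rw [Real.div_rpow two_pos.le hp0.le, ← Real.rpow_natCast, ← Real.rpow_mul hp0.le,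
        show -(1 / p) * ((2 : ℕ) : ℝ) = -(2 / p) by push_cast; ring, Real.rpow_neg hp0.le]
      field_simp
    have hle : (2 / p) ^ (2 / p) ≤ 1 := Real.rpow_le_one (by positivity) he1 (by positivity)
    have hnn : (n : ℝ) ^ (2 / p) * (n : ℝ) ^ (1 - 2 / p) = n := by
      rw [← Real.rpow_add hnpos]; norm_num
    have heq : β ^ 2 * (n : ℝ) ^ (1 - 2 / p) =
        ((2 / p) ^ (2 / p) * 1.1 ^ (2 / p)) * (Real.log n / 640) := by
      calc β ^ 2 * (n : ℝ) ^ (1 - 2 / p)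
          = (p ^ (-(1 / p))) ^ 2 * t ^ 2 * R ^ 2 * (n : ℝ) ^ (1 - 2 / p) := by rw [hβ]; ring
        _ = ((p ^ (-(1 / p))) ^ 2 * 2 ^ (2 / p)) * 1.1 ^ (2 / p) * (Real.log n / 640) *
            (((n : ℝ) ^ (2 / p) * (n : ℝ) ^ (1 - 2 / p)) / n) := by rw [ht, hR2]; field_simp
        _ = _ := by rw [hnn, hp2, div_self hnpos.ne', mul_one]
    rw [heq]
    have : (2 / p) ^ (2 / p) * 1.1 ^ (2 / p) ≤ 1 * 1.1 := by gcongr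
    calc _ ≤ (1 * 1.1) * (Real.log n / 640) := by gcongr
      _ ≤ _ := by linarith
  · have h2e : (2 : ℝ) ^ (2 / p) ≤ 2 := by
      calc (2 : ℝ) ^ (2 / p) ≤ 2 ^ (1 : ℝ) := Real.rpow_le_rpow_of_exponent_le (by norm_num) he1
        _ = 2 := Real.rpow_one _
    have ht2 : t ^ 2 ≤ Real.log n / (320 * n) := by
      rw [ht, div_le_div_iff₀ (by positivity) (by positivity)]
      have : Real.log n * (2 : ℝ) ^ (2 / p) ≤ Real.log n * 2 := by gcongr
      nlinarith
    have ht1 : t ≤ 1 := by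
      have : Real.log n / (320 * n) ≤ 1 := by
        rw [div_le_one (by positivity)]
        linarith
      nlinarith
    have htp : t ^ p ≤ t ^ 2 := by
      rw [← Real.rpow_natCast]
      rcases ht0.eq_or_lt with h | h
      · rw [← h, Real.zero_rpow hp0.ne', Real.zero_rpow (by norm_num)]
      · exact Real.rpow_le_rpow_of_exponent_ge h ht1 (by push_cast; exact hp.le)
    have hβp : |β| ^ p = p⁻¹ * t ^ p * (1.1 * n) := by
      rw [abs_of_nonneg hβ0, hβ, Real.mul_rpow (by positivity) hR0.le,
        Real.mul_rpow (by positivity) ht0, hR, ← Real.rpow_mul hp0.le,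
        ← Real.rpow_mul (by positivity), one_div_mul_cancel hp0.ne', Real.rpow_one,
        show -(1 / p) * p = -1 by field_simp, Real.rpow_neg_one]
    have hpi : p⁻¹ ≤ 1 / 2 := by
      rw [← one_div]; exact one_div_le_one_div_of_le two_pos hp.le
    rw [hβp]
    calc p⁻¹ * t ^ p * (1.1 * n) ≤ 1 / 2 * (Real.log n / (320 * n)) * (1.1 * n) := by
          gcongr
          exact htp.trans ht2
      _ = 1.1 * Real.log n / 640 := by field_simp; ring
      _ ≤ _ := by linarith

theorem exp_neg_mul_const_ge {n : ℕ} (hn : 0 < n) {Q : ℝ} (hQ : 0.07 ≤ Q) :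
    1 / 144 * (n : ℝ) ^ (-(1 : ℝ) / 40) ≤ Real.exp (-(Real.log n / 40 + 2)) * Q := by
  have hn' : (0 : ℝ) < n := by exact_mod_cast hn
  have h1 : Real.exp (-(Real.log n / 40 + 2)) =
      (n : ℝ) ^ (-(1 : ℝ) / 40) * (Real.exp 2)⁻¹ := by
    rw [← Real.exp_neg, Real.rpow_def_of_pos hn', ← Real.exp_add]
    congr 1
    ring
  have h2 : Real.exp 2 ≤ 8 := by
    have := Real.exp_one_lt_d9
    rw [show (2 : ℝ) = 1 + 1 by norm_num, Real.exp_add]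
    have h0 := Real.exp_pos 1
    nlinarith
  have h3 : 1 / 8 ≤ (Real.exp 2)⁻¹ := by
    rw [one_div]; exact inv_anti₀ (Real.exp_pos 2) h2
  rw [h1]
  have h4 : 0 < (n : ℝ) ^ (-(1 : ℝ) / 40) := by positivity
  have h5 : 1 / 144 ≤ (Real.exp 2)⁻¹ * Q :=
    calc (1 / 144 : ℝ) ≤ 1 / 8 * 0.07 := by norm_num
      _ ≤ _ := by gcongr
  calc _ = (n : ℝ) ^ (-(1 : ℝ) / 40) * (1 / 144) := by ring
    _ ≤ (n : ℝ) ^ (-(1 : ℝ) / 40) * ((Real.exp 2)⁻¹ * Q) := by gcongr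
    _ = _ := by ring

set_option maxHeartbeats 1000000 in
theorem shift_lower_bound (hp : 2 < p) (hp' : p ≤ 7 / 3) {n : ℕ} (hn : 41 ≤ n)
    {w b : Fin n → ℝ} {W t : ℝ} (hwb : ∑ i, w i * b i = W) (hb : ∑ i, |b i| ^ p = 1)
    (ht0 : 0 ≤ t) (ht : t ^ 2 = Real.log n * 2 ^ (2 / p) / (640 * n)) :
    ∃ R > 0, 1 / 144 * (n : ℝ) ^ (-(1 : ℝ) / 40) ≤
      (Measure.pi fun _ : Fin n => expPowMeasure p).real
        {x | p ^ (-(1 / p)) * t * R * W ≤ ∑ i, w i * x i ∧ ∑ i, |x i| ^ p ≤ R ^ p} := by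
  have hp0 : 0 < p := by linarith
  have hn0 : (41 : ℝ) ≤ n := by exact_mod_cast hn
  have hnpos : (0 : ℝ) < n := by linarith
  have hL0 : 0 < Real.log n := Real.log_pos (by linarith)
  have hLn : Real.log n ≤ n := (Real.log_le_sub_one_of_pos hnpos).trans (by linarith)
  have := isProbabilityMeasure_expPow hp0
  set R : ℝ := (1.1 * n) ^ (1 / p) with hR
  have hR0 : 0 < R := by positivity
  have hRp : R ^ p = 1.1 * n := by
    rw [hR, ← Real.rpow_mul (by positivity), one_div_mul_cancel hp0.ne', Real.rpow_one]
  set β : ℝ := p ^ (-(1 / p)) * t * R with hβ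
  obtain ⟨hβ2, hβp⟩ := shift_scale_bounds hp hn ht0 ht hR hβ
  set L := Real.log n with hL
  set h : Fin n → ℝ := fun i => β * b i with hh
  set P := Measure.pi fun _ : Fin n => expPowMeasure p with hP
  have hh2 : ∑ i, h i ^ 2 ≤ L / 580 := by
    have := sum_sq_le_of_sum_abs_rpow_le hp.le hb.le
    rw [Fintype.card_fin] at this
    calc ∑ i, h i ^ 2 = β ^ 2 * ∑ i, b i ^ 2 := by
          rw [Finset.mul_sum]; exact Finset.sum_congr rfl fun i _ => by rw [hh]; ring
      _ ≤ β ^ 2 * (n : ℝ) ^ (1 - 2 / p) := by gcongr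
      _ ≤ _ := hβ2
  have hhp : ∑ i, |h i| ^ p ≤ L / 580 := by
    calc ∑ i, |h i| ^ p = |β| ^ p * ∑ i, |b i| ^ p := by
          rw [Finset.mul_sum]
          refine Finset.sum_congr rfl fun i _ => ?_
          rw [hh]
          simp only
          rw [abs_mul, Real.mul_rpow (abs_nonneg _) (abs_nonneg _)]
      _ ≤ _ := by rw [hb, mul_one]; exact hβp
  -- the linear term
  set lin : Fin n → ℝ → ℝ := fun i x => p * h i * (|x| ^ (p - 2) * x) with hlin
  have hlin_meas : ∀ i, Measurable (lin i) := fun i => by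
    rw [hlin]; fun_prop
  have hlin_sq : ∀ i x, lin i x ^ 2 = (p * h i) ^ 2 * |x| ^ (2 * p - 2) := by
    intro i x
    rw [hlin]
    simp only
    rw [mul_pow, sq_abs_rpow_mul_self hp]
  have hlin_mem : ∀ i, MemLp (lin i) 2 (expPowMeasure p) := by
    intro i
    rw [memLp_two_iff_integrable_sq (hlin_meas i).aestronglyMeasurable]
    simp only [hlin_sq]
    exact (integrable_abs_rpow_expPow hp0 (by linarith)).const_mul _
  have hlin0 : ∀ i, ∫ x, lin i x ∂(expPowMeasure p) = 0 := fun i =>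
    integral_eq_zero_of_odd (measurePreserving_neg_expPow p)
      (hlin_meas i).aestronglyMeasurable fun x => by
        rw [hlin]; simp only [abs_neg]; ring
  have hlinv : ∑ i, ∫ x, lin i x ^ 2 ∂(expPowMeasure p) ≤ 28 / 9 * (L / 580) := by
    simp only [hlin_sq, integral_const_mul]
    have hm := integral_abs_rpow_two_mul_sub_two_le_expPow hp.le
    calc _ ≤ ∑ i, (p * h i) ^ 2 * ((p - 1) / p) := by gcongr
      _ = p * (p - 1) * ∑ i, h i ^ 2 := by
        rw [Finset.mul_sum]
        refine Finset.sum_congr rfl fun i _ => ?_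
        field_simp
      _ ≤ 28 / 9 * (L / 580) := by
        gcongr
        nlinarith
  set c₁ : ℝ := L / 200 + 2 with hc₁
  have hPlin : P.real {x | c₁ ≤ |∑ i, lin i (x i)|} ≤ 0.135 := by
    refine (measureReal_abs_sum_ge_le_of_mean_zero hlin_mem hlin0 hlinv (by positivity)).trans ?_
    rw [div_le_iff₀ (by positivity)]
    nlinarith [sq_nonneg (L / 200 - 2)]
  -- the Taylor remainder
  set rem : Fin n → ℝ → ℝ := fun i x =>
    p * (p - 1) / 2 * (h i ^ 2 * |x| ^ (p - 2) + |h i| ^ p) with hrem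
  have hpp : 0 ≤ p * (p - 1) / 2 := by nlinarith
  have hi2 := integrable_abs_rpow_expPow hp0 (s := p - 2) (by linarith)
  have hrem_int : ∀ i, Integrable (rem i) (expPowMeasure p) := fun i =>
    ((hi2.const_mul _).add (integrable_const _)).const_mul _
  have hrem_sum : ∑ i, ∫ x, rem i x ∂(expPowMeasure p) ≤ 28 / 9 * (L / 580) := by
    have h1 : ∀ i, ∫ x, rem i x ∂(expPowMeasure p) ≤
        p * (p - 1) / 2 * (h i ^ 2 + |h i| ^ p) := by
      intro i
      rw [hrem]
      simp only
      rw [integral_const_mul, integral_add (hi2.const_mul _) (integrable_const _),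
        integral_const_mul]
      have h2 := integral_abs_rpow_le_one_expPow (p := p) (s := p - 2) (by linarith)
        (by linarith) (by linarith)
      simp only [integral_const, probReal_univ, one_smul]
      gcongr
      exact mul_le_of_le_one_right (sq_nonneg _) h2
    calc _ ≤ ∑ i, p * (p - 1) / 2 * (h i ^ 2 + |h i| ^ p) := Finset.sum_le_sum fun i _ => h1 i
      _ = p * (p - 1) / 2 * (∑ i, h i ^ 2 + ∑ i, |h i| ^ p) := by
        rw [← Finset.sum_add_distrib, Finset.mul_sum]
      _ ≤ 14 / 9 * (L / 580 + L / 580) := by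
        have : p * (p - 1) / 2 ≤ 14 / 9 := by nlinarith
        gcongr
      _ = _ := by ring
  have hPrem : P.real {x | L / 50 ≤ ∑ i, rem i (x i)} ≤ 0.27 := by
    refine (measureReal_sum_ge_le_of_nonneg hrem_int (fun i x => by positivity) hrem_sum
      (by positivity)).trans ?_
    rw [div_le_iff₀ (by positivity)]
    linarith
  -- the norm
  have hPnorm : P.real {x | n / 2 + n / 2 ≤ ∑ i, |x i| ^ p} ≤ 0.08 := by
    refine (measureReal_sum_ge_le_of_mean (v := n * (3 / 4))
      (fun _ => memLp_two_abs_rpow_expPow hp0) ?_ ?_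
      (by positivity)).trans ?_
    · rw [integral_abs_rpow_self_expPow hp0]
      simp only [Finset.sum_const, Finset.card_univ, Fintype.card_fin, nsmul_eq_mul]
      rw [mul_one_div]
      gcongr
    · have h1 : ∀ x : ℝ, (|x| ^ p) ^ 2 = |x| ^ (2 * p) := fun x => by
        rw [mul_comm 2 p, Real.rpow_mul (abs_nonneg _)]; norm_num
      simp only [h1, integral_abs_rpow_two_mul_expPow hp0]
      simp only [Finset.sum_const, Finset.card_univ, Fintype.card_fin, nsmul_eq_mul]
      have : (p + 1) / p ^ 2 ≤ 3 / 4 := by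
        rw [div_le_div_iff₀ (by positivity) (by norm_num)]
        nlinarith
      gcongr
    · rw [div_le_iff₀ (by positivity)]
      nlinarith
  -- assembling the event
  set S : Set (Fin n → ℝ) := {x | n / 2 + n / 2 ≤ ∑ i, |x i| ^ p}ᶜ ∩
    {x | c₁ ≤ |∑ i, lin i (x i)|}ᶜ with hS
  have hX : Measurable fun x : Fin n → ℝ => ∑ i, w i * x i := by fun_prop
  have hV : Measurable fun x : Fin n → ℝ => ∑ i, |x i| ^ p := by fun_prop
  have hm1 : MeasurableSet {x : Fin n → ℝ | (n : ℝ) / 2 + n / 2 ≤ ∑ i, |x i| ^ p} :=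
    measurableSet_le measurable_const hV
  have hm2 : MeasurableSet {x : Fin n → ℝ | c₁ ≤ |∑ i, lin i (x i)|} :=
    measurableSet_le measurable_const (by fun_prop)
  have hSm : MeasurableSet S := hm1.compl.inter hm2.compl
  have hPS : 1 - 0.08 - 0.135 ≤ P.real S := by
    have h1 := measureReal_union_le (μ := P) {x : Fin n → ℝ | (n : ℝ) / 2 + n / 2 ≤ ∑ i, |x i| ^ p}
      {x | c₁ ≤ |∑ i, lin i (x i)|}
    have h2 := probReal_compl_eq_one_sub (μ := P) (hm1.union hm2)
    rw [Set.compl_union] at h2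
    rw [hS, h2]
    linarith
  have hσ : MeasurePreserving (fun (x : Fin n → ℝ) i => -x i) P P :=
    measurePreserving_pi _ _ fun _ => measurePreserving_neg_expPow p
  have hσS : (fun (x : Fin n → ℝ) i => -x i) ⁻¹' S = S := by
    have h1 : ∀ i x, lin i (-x) = -lin i x := fun i x => by
      rw [hlin]; simp only [abs_neg]; ring
    ext x
    simp [hS, h1, abs_neg]
  have hhalf := half_le_measureReal_inter_nonneg hσ hSm hσS
    (X := fun x => ∑ i, w i * x i) hX (fun x _ => by simp)
  set E := (S ∩ {x | 0 ≤ ∑ i, w i * x i}) \ {x | L / 50 ≤ ∑ i, rem i (x i)} with hE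
  have hPE : 0.07 ≤ P.real E := by
    have h1 : P.real (S ∩ {x | 0 ≤ ∑ i, w i * x i}) -
        P.real {x | L / 50 ≤ ∑ i, rem i (x i)} ≤ P.real E := le_measureReal_sdiff
    linarith
  refine ⟨R, hR0, ?_⟩
  have htaylor : ∀ x ∈ E, ∑ i, (|x i + h i| ^ p - |x i| ^ p) ≤ L / 40 + 2 := by
    rintro x ⟨⟨⟨-, h2⟩, -⟩, h3⟩
    simp only [Set.mem_compl_iff, Set.mem_ofPred_eq, not_le] at h2 h3
    have h4 : ∑ i, (|x i + h i| ^ p - |x i| ^ p) ≤ ∑ i, lin i (x i) + ∑ i, rem i (x i) := by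
      rw [← Finset.sum_add_distrib]
      refine Finset.sum_le_sum fun i _ => ?_
      have := abs_add_rpow_le_taylor hp (by linarith) (x i) (h i)
      rw [hlin, hrem]
      simp only
      linarith
    have := le_abs_self (∑ i, lin i (x i))
    linarith
  refine (exp_neg_mul_const_ge (by omega) hPE).trans ?_
  refine le_pi_of_transport (g := fun i x => Real.exp (-(|x + h i| ^ p - |x| ^ p)))
    (T := fun i x => x + h i) (fun i => by fun_prop) (fun i => by fun_prop)
    (fun i x => Real.exp_nonneg _) (fun i => map_add_withDensity_expPow hp0 (h i)) ?_ ?_ ?_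
  · exact (measurableSet_le measurable_const hX).inter (measurableSet_le hV measurable_const)
  · intro x hx
    have h5 := htaylor x hx
    obtain ⟨⟨⟨h1, -⟩, h4⟩, -⟩ := hx
    simp only [Set.mem_compl_iff, Set.mem_ofPred_eq, not_le] at h1 h4
    constructor
    · have : ∑ i, w i * (x i + h i) = ∑ i, w i * x i + β * W := by
        rw [← hwb, Finset.mul_sum, ← Finset.sum_add_distrib]
        refine Finset.sum_congr rfl fun i _ => ?_
        rw [hh]; ring
      rw [this]
      linarith
    · rw [Finset.sum_sub_distrib] at h5
      rw [hRp]
      linarith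
  · intro x hx
    rw [← Real.exp_sum, Finset.sum_neg_distrib]
    exact Real.exp_le_exp.mpr (neg_le_neg (htaylor x hx))

end ShiftCase

section Uniform

/-- The uniform probability measure on `(-1, 1)`. -/
noncomputable def uniformMeasure : Measure ℝ :=
  ENNReal.ofReal (1 / 2) • volume.restrict (Set.Ioo (-1) 1)

instance : IsProbabilityMeasure uniformMeasure := by
  refine ⟨?_⟩
  rw [uniformMeasure, Measure.smul_apply, Measure.restrict_apply_univ, Real.volume_Ioo,
    smul_eq_mul, ← ENNReal.ofReal_mul (by norm_num)]
  norm_num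

theorem uniformMeasure_apply {s : Set ℝ} (hs : MeasurableSet s) :
    uniformMeasure s = ENNReal.ofReal (1 / 2) * volume (s ∩ Set.Ioo (-1) 1) := by
  rw [uniformMeasure, Measure.smul_apply, Measure.restrict_apply hs, smul_eq_mul]

theorem lintegral_uniformMeasure (f : ℝ → ℝ≥0∞) :
    ∫⁻ u, f u ∂uniformMeasure =
      ENNReal.ofReal (1 / 2) * ∫⁻ u in Set.Ioo (-1) 1, f u := by
  rw [uniformMeasure, lintegral_smul_measure, smul_eq_mul]

theorem setLIntegral_Ioo_split {m : ℝ} (h1 : -1 ≤ m) (h2 : m ≤ 1) (f : ℝ → ℝ≥0∞) :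
    ∫⁻ u in Set.Ioo (-1) 1, f u = (∫⁻ u in Set.Ioo (-1) m, f u) + ∫⁻ u in Set.Ioo m 1, f u := by
  rw [setLIntegral_congr Ioo_ae_eq_Ioc, ← Set.Ioc_union_Ioc_eq_Ioc h1 h2,
    lintegral_union measurableSet_Ioc (Set.Ioc_disjoint_Ioc_of_le le_rfl),
    setLIntegral_congr Ioo_ae_eq_Ioc.symm, setLIntegral_congr Ioo_ae_eq_Ioc.symm]

theorem setLIntegral_affine {α β a b c d : ℝ} (hα : α ≠ 0)
    (him : (fun u : ℝ => α * u + β) '' Set.Ioo a b = Set.Ioo c d) (f : ℝ → ℝ≥0∞) :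
    ∫⁻ u in Set.Ioo a b, ENNReal.ofReal |α| * f (α * u + β) = ∫⁻ u in Set.Ioo c d, f u := by
  rw [← him, lintegral_image_eq_lintegral_abs_deriv_mul measurableSet_Ioo (f' := fun _ => α)]
  · intro x _
    simpa using (((hasDerivAt_id x).const_mul α).add_const β).hasDerivWithinAt
  · intro x _ y _ hxy
    simpa [hα] using hxy

theorem map_withDensity_uniform_of_piecewise_affine {T g : ℝ → ℝ} (hT : Measurable T)
    (hg : Measurable g) {α₁ β₁ α₂ β₂ m : ℝ} (hm1 : -1 ≤ m) (hm2 : m ≤ 1) (hα₁ : α₁ ≠ 0)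
    (hα₂ : α₂ ≠ 0)
    (h₁ : ∀ u ∈ Set.Ioo (-1 : ℝ) 0, T u = α₁ * u + β₁ ∧ g u = |α₁|)
    (h₂ : ∀ u ∈ Set.Ioo (0 : ℝ) 1, T u = α₂ * u + β₂ ∧ g u = |α₂|)
    (him₁ : (fun u : ℝ => α₁ * u + β₁) '' Set.Ioo (-1) 0 = Set.Ioo (-1) m)
    (him₂ : (fun u : ℝ => α₂ * u + β₂) '' Set.Ioo 0 1 = Set.Ioo m 1) :
    (uniformMeasure.withDensity fun u => ENNReal.ofReal (g u)).map T = uniformMeasure := by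
  refine Measure.ext_of_lintegral _ fun f hf => ?_
  rw [lintegral_map hf hT]
  refine (lintegral_withDensity_eq_lintegral_mul _ hg.ennreal_ofReal (hf.comp hT)).trans ?_
  rw [lintegral_uniformMeasure, lintegral_uniformMeasure,
    setLIntegral_Ioo_split (m := 0) (by norm_num) (by norm_num), setLIntegral_Ioo_split hm1 hm2,
    ← setLIntegral_affine hα₁ him₁, ← setLIntegral_affine hα₂ him₂]
  congr 2
  · refine setLIntegral_congr_fun measurableSet_Ioo fun u hu => ?_
    simp only [Pi.mul_apply, Function.comp, (h₁ u hu).1, (h₁ u hu).2]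
  · refine setLIntegral_congr_fun measurableSet_Ioo fun u hu => ?_
    simp only [Pi.mul_apply, Function.comp, (h₂ u hu).1, (h₂ u hu).2]

theorem image_affine_Ioo_of_pos {α β a b : ℝ} (hα : 0 < α) :
    (fun u : ℝ => α * u + β) '' Set.Ioo a b = Set.Ioo (α * a + β) (α * b + β) := by
  rw [← Set.image_image (fun u => u + β) (fun u => α * u), Set.image_mul_left_Ioo hα,
    Set.image_add_const_Ioo]

theorem measurable_sign_coe : Measurable fun u : ℝ => ((SignType.sign u : SignType) : ℝ) := by
  have h : (fun u : ℝ => ((SignType.sign u : SignType) : ℝ)) =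
      fun u => if 0 < u then 1 else if u < 0 then -1 else 0 := by
    ext u
    rw [sign_apply]
    split_ifs <;> simp
  rw [h]
  exact Measurable.ite measurableSet_Ioi measurable_const
    (Measurable.ite measurableSet_Iio measurable_const measurable_const)

theorem map_withDensity_uniform_contract {b : ℝ} (hb : |b| < 1) :
    (uniformMeasure.withDensity fun u => ENNReal.ofReal (1 - b * SignType.sign u)).map
      (fun u => u + b * (1 - |u|)) = uniformMeasure := by
  obtain ⟨hb1, hb2⟩ := abs_lt.mp hb
  have hs := measurable_sign_coe
  refine map_withDensity_uniform_of_piecewise_affine (by fun_prop)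
    (measurable_const.sub (hs.const_mul b)) (m := b) (α₁ := 1 + b) (β₁ := b) (α₂ := 1 - b) (β₂ := b)
    hb1.le hb2.le (by linarith) (by linarith) ?_ ?_ ?_ ?_
  · intro u hu
    rw [abs_of_neg hu.2, sign_neg hu.2, abs_of_pos (by linarith)]
    constructor
    · ring
    · simp
  · intro u hu
    rw [abs_of_pos hu.1, sign_pos hu.1, abs_of_pos (by linarith)]
    constructor
    · ring
    · simp
  · rw [image_affine_Ioo_of_pos (by linarith)]
    congr 1 <;> ring
  · rw [image_affine_Ioo_of_pos (by linarith)]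
    congr 1 <;> ring

/-- The involution exchanging the ends of each of the intervals `(-1, 0)` and `(0, 1)`. -/
noncomputable def flipHalves (u : ℝ) : ℝ :=
  if u ∈ Set.Ioo (0 : ℝ) 1 then 1 - u else if u ∈ Set.Ioo (-1 : ℝ) 0 then -1 - u else u

theorem measurable_flipHalves : Measurable flipHalves :=
  Measurable.ite measurableSet_Ioo (by fun_prop)
    (Measurable.ite measurableSet_Ioo (by fun_prop) measurable_id)

theorem flipHalves_of_mem {u : ℝ} (hu : u ∈ Set.Ioo (-1 : ℝ) 0 ∪ Set.Ioo 0 1) :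
    flipHalves u ∈ Set.Ioo (-1 : ℝ) 0 ∪ Set.Ioo 0 1 ∧ |flipHalves u| = 1 - |u| := by
  rcases hu with h | h
  · have h' : u ∉ Set.Ioo (0 : ℝ) 1 := fun h' => absurd h'.1 (not_lt.mpr h.2.le)
    rw [flipHalves, if_neg h', if_pos h]
    refine ⟨Or.inl ⟨by linarith [h.2], by linarith [h.1]⟩, ?_⟩
    rw [abs_of_neg h.2, abs_of_neg (by linarith [h.1])]
    ring
  · rw [flipHalves, if_pos h]
    refine ⟨Or.inr ⟨by linarith [h.2], by linarith [h.1]⟩, ?_⟩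
    rw [abs_of_pos h.1, abs_of_pos (by linarith [h.2])]

theorem flipHalves_mem_iff {u : ℝ} : flipHalves u ∈ Set.Ioo (-1 : ℝ) 0 ∪ Set.Ioo 0 1 ↔
    u ∈ Set.Ioo (-1 : ℝ) 0 ∪ Set.Ioo 0 1 := by
  refine ⟨fun h => ?_, fun h => (flipHalves_of_mem h).1⟩
  by_contra hu
  rw [Set.mem_union, not_or] at hu
  rw [flipHalves, if_neg hu.2, if_neg hu.1] at h
  exact (not_or.mpr hu) h

theorem measurePreserving_flipHalves :
    MeasurePreserving flipHalves uniformMeasure uniformMeasure := by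
  refine ⟨measurable_flipHalves, ?_⟩
  have h := map_withDensity_uniform_of_piecewise_affine (T := flipHalves) (g := fun _ => 1)
    measurable_flipHalves measurable_const (m := 0) (α₁ := -1) (β₁ := -1) (α₂ := -1) (β₂ := 1)
    (by norm_num) (by norm_num) (by norm_num) (by norm_num) ?_ ?_ ?_ ?_
  · simpa using h
  · intro u h
    have h' : u ∉ Set.Ioo (0 : ℝ) 1 := fun h' => absurd h'.1 (not_lt.mpr h.2.le)
    rw [flipHalves, if_neg h', if_pos h]
    exact ⟨by ring, by norm_num⟩
  · intro u h
    rw [flipHalves, if_pos h]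
    exact ⟨by ring, by norm_num⟩
  · ext u
    simp only [Set.mem_image, Set.mem_Ioo]
    constructor
    · rintro ⟨x, hx, rfl⟩; constructor <;> linarith
    · intro hu; exact ⟨-1 - u, ⟨by linarith, by linarith⟩, by ring⟩
  · ext u
    simp only [Set.mem_image, Set.mem_Ioo]
    constructor
    · rintro ⟨x, hx, rfl⟩; constructor <;> linarith
    · intro hu; exact ⟨1 - u, ⟨by linarith, by linarith⟩, by ring⟩

theorem measurePreserving_neg_uniform :
    MeasurePreserving (fun u : ℝ => -u) uniformMeasure uniformMeasure := by
  refine ⟨measurable_neg, ?_⟩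
  ext s hs
  rw [Measure.map_apply measurable_neg hs, uniformMeasure_apply (measurable_neg hs),
    uniformMeasure_apply hs,
    ← (Measure.measurePreserving_neg (volume : Measure ℝ)).measure_preimage
      (hs.inter measurableSet_Ioo).nullMeasurableSet, Set.preimage_inter]
  congr 3
  ext u
  simp [and_comm, neg_lt]

theorem ae_uniform_mem : ∀ᵐ u ∂uniformMeasure, u ∈ Set.Ioo (-1 : ℝ) 0 ∪ Set.Ioo 0 1 := by
  have h1 : uniformMeasure (Set.Ioo (-1 : ℝ) 0 ∪ Set.Ioo 0 1)ᶜ = 0 := by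
    rw [uniformMeasure_apply (by measurability)]
    have : (Set.Ioo (-1 : ℝ) 0 ∪ Set.Ioo 0 1)ᶜ ∩ Set.Ioo (-1) 1 ⊆ {0} := by
      rintro u ⟨h1, h2⟩
      simp only [Set.mem_compl_iff, Set.mem_union, not_or, Set.mem_Ioo, not_and, not_lt] at h1
      have h3 := h1.1 h2.1
      by_contra h4
      exact absurd (h1.2 (lt_of_le_of_ne h3 (Ne.symm h4))) (not_le.mpr h2.2)
    rw [measure_mono_null this (by simp), mul_zero]
  exact h1

theorem map_uniform_contract_le {b : ℝ} (hb : |b| ≤ 1 / 5) :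
    uniformMeasure.map (fun u => u + b * (1 - |u|)) ≤ ENNReal.ofReal (5 / 4) • uniformMeasure := by
  have hT : Measurable fun u : ℝ => u + b * (1 - |u|) := by fun_prop
  have hs := measurable_sign_coe
  have hg : Measurable fun u : ℝ => ENNReal.ofReal (1 - b * SignType.sign u) :=
    (measurable_const.sub (hs.const_mul b)).ennreal_ofReal
  have h1 : uniformMeasure ≤ ENNReal.ofReal (5 / 4) •
      uniformMeasure.withDensity fun u => ENNReal.ofReal (1 - b * SignType.sign u) := by
    rw [← withDensity_smul _ hg]
    conv_lhs => rw [← withDensity_one (μ := uniformMeasure)]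
    refine withDensity_mono (Filter.Eventually.of_forall fun u => ?_)
    simp only [Pi.one_apply, Pi.smul_apply, smul_eq_mul]
    rw [← ENNReal.ofReal_mul (by norm_num), ENNReal.one_le_ofReal]
    have : b * SignType.sign u ≤ 1 / 5 := by
      obtain ⟨h2, h3⟩ := abs_le.mp hb
      rcases lt_trichotomy u 0 with h | h | h
      · rw [sign_neg h, SignType.coe_neg_one]; linarith
      · simp [h]
      · rw [sign_pos h, SignType.coe_one]; linarith
    linarith
  refine (Measure.map_mono h1 hT).trans (le_of_eq ?_)
  rw [Measure.map_smul, map_withDensity_uniform_contract (hb.trans_lt (by norm_num))]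

end Uniform

section Quantile

variable {p : ℝ}

theorem expPowMeasure_Ioc_le (hp : 1 < p) (x y : ℝ) :
    expPowMeasure p (Set.Ioc x y) ≤ ENNReal.ofReal (p ^ (1 / p) / 2 * (y - x)) := by
  have hp0 : 0 < p := by linarith
  rw [expPowMeasure, withDensity_apply _ measurableSet_Ioc]
  calc _ ≤ ∫⁻ _ in Set.Ioc x y, ENNReal.ofReal (p ^ (1 / p) / 2) :=
        lintegral_mono fun t => ENNReal.ofReal_le_ofReal (expPow_density_le hp t)
    _ = _ := by
        rw [setLIntegral_const, Real.volume_Ioc, ← ENNReal.ofReal_mul (by positivity)]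

theorem expPowMeasure_Ioc_pos (hp : 0 < p) {x y : ℝ} (h : x < y) :
    0 < expPowMeasure p (Set.Ioc x y) := by
  have hG : 0 < Real.Gamma (1 / p) := Real.Gamma_pos_of_pos (by positivity)
  have hac : (volume : Measure ℝ) ≪ expPowMeasure p :=
    withDensity_absolutelyContinuous' (measurable_expPow_density p).ennreal_ofReal.aemeasurable
      (Filter.Eventually.of_forall fun t => by
        rw [Ne, ENNReal.ofReal_eq_zero, not_le]
        positivity)
  rw [pos_iff_ne_zero]
  intro h0
  have := hac h0
  rw [Real.volume_Ioc, ENNReal.ofReal_eq_zero] at this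
  linarith

theorem exists_quantile_expPow (hp : 1 < p) : ∃ G : ℝ → ℝ,
    MeasurePreserving G uniformMeasure (expPowMeasure p) ∧
    (∀ u ∈ Set.Ioo (-1 : ℝ) 1, G (-u) = -G u) ∧
    ∀ u ∈ Set.Ioo (-1 : ℝ) 1, ∀ v ∈ Set.Ioo (-1 : ℝ) 1, u ≤ v →
      p ^ (-(1 / p)) * (v - u) ≤ G v - G u := by
  have hp0 : 0 < p := by linarith
  have := isProbabilityMeasure_expPow hp0
  set μ := expPowMeasure p with hμ
  set F : ℝ → ℝ := fun x => 2 * μ.real (Set.Iic x) - 1 with hF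
  have hsub : ∀ {x y : ℝ}, x ≤ y → F y - F x = 2 * μ.real (Set.Ioc x y) := by
    intro x y hxy
    have h1 : μ.real (Set.Iic y) = μ.real (Set.Iic x) + μ.real (Set.Ioc x y) := by
      rw [← Set.Iic_union_Ioc_eq_Iic hxy]
      exact measureReal_union (Set.Iic_disjoint_Ioc le_rfl) measurableSet_Ioc
    rw [hF]
    simp only
    linarith
  have hmono : StrictMono F := by
    intro x y hxy
    have h1 : 0 < μ.real (Set.Ioc x y) :=
      ENNReal.toReal_pos (expPowMeasure_Ioc_pos hp0 hxy).ne' (measure_ne_top _ _)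
    linarith [hsub hxy.le]
  have hlip : ∀ {x y : ℝ}, x ≤ y → F y - F x ≤ p ^ (1 / p) * (y - x) := by
    intro x y hxy
    have h1 : μ.real (Set.Ioc x y) ≤ p ^ (1 / p) / 2 * (y - x) :=
      ENNReal.toReal_le_of_le_ofReal (mul_nonneg (by positivity) (sub_nonneg.mpr hxy))
        (expPowMeasure_Ioc_le hp x y)
    linarith [hsub hxy]
  have hcont : Continuous F := by
    refine (LipschitzWith.of_le_add_mul' (p ^ (1 / p)) fun x y => ?_).continuous
    rw [Real.dist_eq]
    have hc : 0 ≤ p ^ (1 / p) := by positivity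
    rcases le_total x y with h | h
    · have := hmono.monotone h
      have := mul_nonneg hc (abs_nonneg (x - y))
      linarith
    · rw [abs_of_nonneg (sub_nonneg.mpr h)]
      linarith [hlip h]
  have hodd : ∀ x, F (-x) = -F x := by
    intro x
    have h1 : μ (Set.Iic (-x)) = μ (Set.Ici x) := by
      rw [← (measurePreserving_neg_expPow p).measure_preimage measurableSet_Ici.nullMeasurableSet]
      congr 1
      ext y
      simp
    have h2 : μ.real (Set.Ici x) = 1 - μ.real (Set.Iio x) := by
      rw [← Set.compl_Iio, probReal_compl_eq_one_sub measurableSet_Iio]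
    have hx0 : μ {x} = 0 := by
      rw [hμ, expPowMeasure]
      exact withDensity_absolutelyContinuous _ _ (by simp)
    have h3 : μ.real (Set.Iic x) = μ.real (Set.Iio x) := by
      refine measureReal_congr ?_
      rw [← Set.Iio_union_right]
      exact union_ae_eq_left_of_ae_eq_empty (ae_eq_empty.mpr hx0)
    have h4 : μ.real (Set.Iic (-x)) = μ.real (Set.Ici x) := by
      rw [measureReal_def, h1, ← measureReal_def]
    rw [hF]
    simp only
    linarith
  have hFmem : ∀ x, F x ∈ Set.Ioo (-1 : ℝ) 1 := by
    intro x
    have h1 := hmono (sub_one_lt x)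
    have h2 := hmono (lt_add_one x)
    have h3 : 0 ≤ μ.real (Set.Iic (x - 1)) := measureReal_nonneg
    have h4 : μ.real (Set.Iic (x + 1)) ≤ 1 := measureReal_le_one
    have h5 : F (x - 1) = 2 * μ.real (Set.Iic (x - 1)) - 1 := rfl
    have h6 : F (x + 1) = 2 * μ.real (Set.Iic (x + 1)) - 1 := rfl
    constructor <;> linarith
  have hsurj : ∀ u ∈ Set.Ioo (-1 : ℝ) 1, u ∈ Set.range F := by
    intro u hu
    have ht : Filter.Tendsto F Filter.atTop (nhds 1) := by
      have := ((ProbabilityTheory.tendsto_cdf_atTop μ).const_mul 2).sub_const 1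
      simp only [ProbabilityTheory.cdf_eq_real] at this
      norm_num at this
      exact this
    obtain ⟨y, hy⟩ := (ht.eventually (lt_mem_nhds hu.2)).exists
    obtain ⟨x, hx⟩ := (ht.eventually (lt_mem_nhds (show -u < 1 by linarith [hu.1]))).exists
    refine mem_range_of_exists_le_of_exists_ge hcont ⟨-x, ?_⟩ ⟨y, hy.le⟩
    rw [hodd]
    linarith
  set G : ℝ → ℝ := fun u => if u ∈ Set.Ioo (-1 : ℝ) 1 then Function.invFun F u else 0 with hG
  have hFG : ∀ u ∈ Set.Ioo (-1 : ℝ) 1, F (G u) = u := by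
    intro u hu
    rw [hG]
    simp only [if_pos hu]
    exact Function.invFun_eq (hsurj u hu)
  have hGle : ∀ u ∈ Set.Ioo (-1 : ℝ) 1, ∀ x, G u ≤ x ↔ u ≤ F x := by
    intro u hu x
    conv_rhs => rw [← hFG u hu]
    exact hmono.le_iff_le.symm
  have hpre : ∀ x, G ⁻¹' Set.Iic x ∩ Set.Ioo (-1) 1 = Set.Ioc (-1) (F x) := by
    intro x
    ext u
    simp only [Set.mem_inter_iff, Set.mem_preimage, Set.mem_Iic]
    constructor
    · rintro ⟨h1, h2⟩
      exact ⟨h2.1, (hGle u h2 x).mp h1⟩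
    · intro h
      have h2 : u ∈ Set.Ioo (-1 : ℝ) 1 := ⟨h.1, h.2.trans_lt (hFmem x).2⟩
      exact ⟨(hGle u h2 x).mpr h.2, h2⟩
  have hGm : Measurable G := by
    refine measurable_of_Iic fun x => ?_
    rw [← Set.inter_union_compl (G ⁻¹' Set.Iic x) (Set.Ioo (-1) 1), hpre]
    refine measurableSet_Ioc.union ?_
    by_cases hx : 0 ≤ x
    · convert (measurableSet_Ioo (a := (-1 : ℝ)) (b := 1)).compl using 1
      refine Set.inter_eq_right.mpr fun u hu => ?_
      simp only [Set.mem_preimage, hG, if_neg hu, Set.mem_Iic, hx]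
    · convert MeasurableSet.empty using 1
      refine Set.eq_empty_of_forall_notMem fun u hu => hx ?_
      have := hu.1
      simpa only [Set.mem_preimage, hG, if_neg hu.2, Set.mem_Iic] using this
  refine ⟨G, ⟨hGm, ?_⟩, ?_, ?_⟩
  · have := Measure.isProbabilityMeasure_map (μ := uniformMeasure) hGm.aemeasurable
    refine Measure.ext_of_Iic _ _ fun x => ?_
    rw [Measure.map_apply hGm measurableSet_Iic, uniformMeasure_apply (hGm measurableSet_Iic),
      hpre, Real.volume_Ioc, ← ENNReal.ofReal_mul (by norm_num),
      ← ofReal_measureReal (measure_ne_top μ _)]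
    congr 1
    rw [hF]
    ring
  · intro u hu
    have hu' : -u ∈ Set.Ioo (-1 : ℝ) 1 := ⟨by linarith [hu.2], by linarith [hu.1]⟩
    refine hmono.injective ?_
    rw [hodd, hFG u hu, hFG (-u) hu']
  · intro u hu v hv huv
    have h1 : G u ≤ G v := by
      rw [hGle u hu, hFG v hv]
      exact huv
    have h2 := hlip h1
    rw [hFG u hu, hFG v hv] at h2
    calc _ ≤ p ^ (-(1 / p)) * (p ^ (1 / p) * (G v - G u)) := by gcongr
      _ = _ := by
        rw [← mul_assoc, ← Real.rpow_add hp0]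
        simp

end Quantile

section TransportCase

variable {p : ℝ}

theorem exp_neg_sub_sq_le_one_sub {z : ℝ} (hz : |z| ≤ 1 / 5) :
    Real.exp (-(z + z ^ 2)) ≤ 1 - z := by
  have hz1 : z ≤ 1 / 5 := (le_abs_self z).trans hz
  rw [← Real.le_log_iff_exp_le (by linarith)]
  have h := Real.abs_log_sub_add_sum_range_le (x := z) (by linarith) 2
  simp only [Finset.sum_range_succ, Finset.sum_range_zero] at h
  norm_num at h
  have h1 : |z| ^ 3 / (1 - |z|) ≤ z ^ 2 / 4 := by
    rw [div_le_iff₀ (by linarith), ← sq_abs z]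
    nlinarith [sq_nonneg |z|, abs_nonneg z]
  have := (abs_le.mp h).1
  nlinarith [sq_nonneg z]

theorem transport_scale_bounds (hp : 7 / 3 ≤ p) {n : ℕ} (hn : 41 ≤ n) {t β : ℝ}
    (ht : t ^ 2 = Real.log n * 2 ^ (2 / p) / (640 * n)) (hβ : β = 2 * t * (n : ℝ) ^ (1 / p)) :
    β ^ 2 * (n : ℝ) ^ (1 - 2 / p) ≤ Real.log n / 80 ∧ β ≤ 1 / 5 := by
  have hp0 : 0 < p := by linarith
  have hn0 : (41 : ℝ) ≤ n := by exact_mod_cast hn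
  have hnpos : (0 : ℝ) < n := by linarith
  have hL0 : 0 < Real.log n := Real.log_pos (by linarith)
  have he1 : 2 / p ≤ 6 / 7 := by
    rw [div_le_div_iff₀ hp0 (by norm_num)]; linarith
  have h2e : (2 : ℝ) ^ (2 / p) ≤ 2 := by
    calc (2 : ℝ) ^ (2 / p) ≤ 2 ^ (1 : ℝ) :=
          Real.rpow_le_rpow_of_exponent_le (by norm_num) (by linarith)
      _ = 2 := Real.rpow_one _
  have hβ2 : β ^ 2 = Real.log n * 2 ^ (2 / p) / 160 * (n : ℝ) ^ (2 / p - 1) := by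
    have h1 : ((n : ℝ) ^ (1 / p)) ^ 2 = (n : ℝ) ^ (2 / p) := by
      rw [← Real.rpow_natCast, ← Real.rpow_mul hnpos.le]
      congr 1
      push_cast
      ring
    rw [hβ, mul_pow, mul_pow, ht, h1, Real.rpow_sub hnpos, Real.rpow_one]
    field_simp
    norm_num
  have hle : Real.log n * 2 ^ (2 / p) / 160 ≤ Real.log n / 80 := by
    have := mul_le_mul_of_nonneg_left h2e hL0.le
    linarith
  constructor
  · rw [hβ2, mul_assoc, ← Real.rpow_add hnpos]
    simpa using hle
  · have hm : (n : ℝ) ^ (2 / p - 1) ≤ (n : ℝ) ^ (-(1 / 7) : ℝ) :=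
      Real.rpow_le_rpow_of_exponent_le (by linarith) (by linarith)
    set y : ℝ := (n : ℝ) ^ (1 / 7 : ℝ) with hy
    have hy0 : 0 < y := by positivity
    have hlog : Real.log n = 7 * Real.log y := by
      rw [hy, Real.log_rpow hnpos]; ring
    have hinv : (n : ℝ) ^ (-(1 / 7) : ℝ) = y⁻¹ := by rw [Real.rpow_neg hnpos.le]
    have hly : Real.log y ≤ y / Real.exp 1 := by
      have h1 := Real.log_le_sub_one_of_pos (div_pos hy0 (Real.exp_pos 1))
      rw [Real.log_div hy0.ne' (Real.exp_ne_zero 1), Real.log_exp] at h1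
      linarith
    have hye : y / Real.exp 1 ≤ y / 2.7 := by
      have := Real.exp_one_gt_d9
      exact div_le_div_of_nonneg_left hy0.le (by norm_num) (by linarith)
    have h25 : β ^ 2 ≤ (1 / 5) ^ 2 := by
      calc β ^ 2 ≤ Real.log n / 80 * y⁻¹ := by
            rw [hβ2, ← hinv]; gcongr
        _ ≤ 7 * (y / 2.7) / 80 * y⁻¹ := by
            rw [hlog]
            gcongr
            exact hly.trans hye
        _ = 7 / 216 := by field_simp; norm_num
        _ ≤ _ := by norm_num
    exact le_of_sq_le_sq h25 (by norm_num)

theorem contract_mem_Ioo {b u : ℝ} (hb : |b| < 1) (hu : |u| < 1) :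
    u + b * (1 - |u|) ∈ Set.Ioo (-1 : ℝ) 1 := by
  obtain ⟨h1, h2⟩ := abs_lt.mp hb
  obtain ⟨h3, h4⟩ := abs_le.mp (le_refl |u|)
  constructor <;> nlinarith

theorem mul_sub_le_mul_sub_contract {G : ℝ → ℝ} {c : ℝ}
    (hG : ∀ u ∈ Set.Ioo (-1 : ℝ) 1, ∀ v ∈ Set.Ioo (-1 : ℝ) 1, u ≤ v → c * (v - u) ≤ G v - G u)
    {w b u : ℝ} (hwb : 0 ≤ w * b) (hb : |b| < 1) (hu : |u| < 1) :
    c * (w * b) * (1 - |u|) ≤ w * G (u + b * (1 - |u|)) - w * G u := by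
  have h1 := contract_mem_Ioo hb hu
  have h2 : u ∈ Set.Ioo (-1 : ℝ) 1 := abs_lt.mp hu
  have hu0 : 0 ≤ 1 - |u| := by linarith
  rcases mul_nonneg_iff.mp hwb with ⟨hw, hb0⟩ | ⟨hw, hb0⟩
  · have h3 := hG u h2 _ h1 (by have := mul_nonneg hb0 hu0; linarith)
    have := mul_le_mul_of_nonneg_left h3 hw
    linarith
  · have h3 := hG _ h1 u h2 (by have := mul_nonneg (neg_nonneg.mpr hb0) hu0; linarith)
    have := mul_le_mul_of_nonneg_left h3 (neg_nonneg.mpr hw)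
    linarith

theorem memLp_comp_and_integral_le_of_map_le {ν μ : Measure ℝ} {H : ℝ → ℝ} (hH : Measurable H)
    {C : ℝ} (hC : 0 ≤ C) (hle : ν.map H ≤ ENNReal.ofReal C • μ) {φ : ℝ → ℝ} (hφ : Measurable φ)
    (hφ0 : ∀ x, 0 ≤ φ x) (hφ1 : Integrable φ μ) (hφ2 : MemLp φ 2 μ) :
    MemLp (fun u => φ (H u)) 2 ν ∧ ∫ u, φ (H u) ∂ν ≤ C * ∫ x, φ x ∂μ ∧
      ∫ u, φ (H u) ^ 2 ∂ν ≤ C * ∫ x, φ x ^ 2 ∂μ := by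
  have key : ∀ ψ : ℝ → ℝ, Measurable ψ → (∀ x, 0 ≤ ψ x) → Integrable ψ μ →
      ∫ u, ψ (H u) ∂ν ≤ C * ∫ x, ψ x ∂μ := by
    intro ψ hψ hψ0 hψ1
    rw [← integral_map hH.aemeasurable hψ.aestronglyMeasurable]
    refine (integral_mono_measure hle (Filter.Eventually.of_forall hψ0)
      (hψ1.smul_measure ENNReal.ofReal_ne_top)).trans (le_of_eq ?_)
    rw [integral_smul_measure, ENNReal.toReal_ofReal hC, smul_eq_mul]
  refine ⟨?_, key φ hφ hφ0 hφ1, key (fun x => φ x ^ 2) (hφ.pow_const 2) (fun x => sq_nonneg _)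
    hφ2.integrable_sq⟩
  have h1 : MemLp φ 2 (ν.map H) :=
    (hφ2.smul_measure ENNReal.ofReal_ne_top).mono_measure hle
  exact (memLp_map_measure_iff hφ.aestronglyMeasurable hH.aemeasurable).mp h1

set_option maxHeartbeats 1000000 in
theorem transport_lower_bound (hp : 7 / 3 ≤ p) {n : ℕ} (hn : 41 ≤ n)
    {w b : Fin n → ℝ} {W t : ℝ} (hW : 0 ≤ W) (hwb : ∀ i, w i * b i = W * |b i| ^ p)
    (hb : ∑ i, |b i| ^ p = 1) (ht0 : 0 ≤ t)
    (ht : t ^ 2 = Real.log n * 2 ^ (2 / p) / (640 * n)) :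
    ∃ R > 0, 1 / 144 * (n : ℝ) ^ (-(1 : ℝ) / 40) ≤
      (Measure.pi fun _ : Fin n => expPowMeasure p).real
        {x | p ^ (-(1 / p)) * t * R * W ≤ ∑ i, w i * x i ∧ ∑ i, |x i| ^ p ≤ R ^ p} := by
  have hp0 : 0 < p := by linarith
  have hn0 : (41 : ℝ) ≤ n := by exact_mod_cast hn
  have hnpos : (0 : ℝ) < n := by linarith
  have hL0 : 0 < Real.log n := Real.log_pos (by linarith)
  have := isProbabilityMeasure_expPow hp0
  set R : ℝ := (n : ℝ) ^ (1 / p) with hR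
  have hR0 : 0 < R := by positivity
  have hRp : R ^ p = n := by
    rw [hR, ← Real.rpow_mul (by positivity), one_div_mul_cancel hp0.ne', Real.rpow_one]
  set β : ℝ := 2 * t * R with hβ
  obtain ⟨hβ2, hβ5⟩ := transport_scale_bounds hp hn ht hβ
  have hβ0 : 0 ≤ β := by positivity
  set L := Real.log n with hL
  set h : Fin n → ℝ := fun i => β * b i with hh
  have hh2 : ∑ i, h i ^ 2 ≤ L / 80 := by
    have := sum_sq_le_of_sum_abs_rpow_le (p := p) (by linarith) hb.le
    rw [Fintype.card_fin] at this
    calc ∑ i, h i ^ 2 = β ^ 2 * ∑ i, b i ^ 2 := by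
          rw [Finset.mul_sum]; exact Finset.sum_congr rfl fun i _ => by rw [hh]; ring
      _ ≤ β ^ 2 * (n : ℝ) ^ (1 - 2 / p) := by gcongr
      _ ≤ _ := hβ2
  have hh5 : ∀ i, |h i| ≤ 1 / 5 := by
    intro i
    have h1 : |b i| ^ p ≤ 1 := by
      rw [← hb]
      exact Finset.single_le_sum (f := fun i => |b i| ^ p) (fun j _ => by positivity)
        (Finset.mem_univ i)
    have h2 : |b i| ≤ 1 := by
      by_contra! h3
      exact absurd (Real.one_lt_rpow h3 hp0) (not_lt.mpr h1)
    rw [hh]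
    simp only
    rw [abs_mul, abs_of_nonneg hβ0]
    calc β * |b i| ≤ 1 / 5 * 1 := by gcongr
      _ = _ := by norm_num
  have hh1 : ∀ i, |h i| < 1 := fun i => (hh5 i).trans_lt (by norm_num)
  obtain ⟨G, hGP, hGodd, hGincr⟩ := exists_quantile_expPow (p := p) (by linarith)
  have hGm := hGP.measurable
  set T : Fin n → ℝ → ℝ := fun i u => u + h i * (1 - |u|) with hT
  have hTm : ∀ i, Measurable (T i) := fun i => by rw [hT]; fun_prop
  set P := Measure.pi fun _ : Fin n => uniformMeasure with hP
  -- the linear term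
  have hsm := measurable_sign_coe
  set lin : Fin n → ℝ → ℝ := fun i u => h i * (SignType.sign u : SignType) with hlin
  have hlin_meas : ∀ i, Measurable (lin i) := fun i => hsm.const_mul (h i)
  have hlin_odd : ∀ i u, lin i (-u) = -lin i u := fun i u => by
    rw [hlin]
    simp only
    rw [Left.sign_neg, SignType.coe_neg, mul_neg]
  have hlin_abs : ∀ i u, |lin i u| ≤ |h i| := fun i u => by
    rw [hlin]
    simp only
    rw [abs_mul]
    refine mul_le_of_le_one_right (abs_nonneg _) ?_
    cases SignType.sign u <;> simp
  have hlin_mem : ∀ i, MemLp (lin i) 2 uniformMeasure := fun i =>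
    MemLp.of_bound (hlin_meas i).aestronglyMeasurable |h i|
      (Filter.Eventually.of_forall fun u => hlin_abs i u)
  have hlin0 : ∀ i, ∫ u, lin i u ∂uniformMeasure = 0 := fun i =>
    integral_eq_zero_of_odd measurePreserving_neg_uniform
      (hlin_meas i).aestronglyMeasurable (hlin_odd i)
  have hlinv : ∑ i, ∫ u, lin i u ^ 2 ∂uniformMeasure ≤ L / 80 := by
    refine (Finset.sum_le_sum fun i _ => ?_).trans hh2
    calc ∫ u, lin i u ^ 2 ∂uniformMeasure ≤ ∫ _, h i ^ 2 ∂uniformMeasure :=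
          integral_mono (hlin_mem i).integrable_sq (integrable_const _)
            fun u => sq_le_sq.mpr (hlin_abs i u)
      _ = _ := by simp
  set c₁ : ℝ := L / 80 + 2 with hc₁
  have hPlin : P.real {x | c₁ ≤ |∑ i, lin i (x i)|} ≤ 0.125 := by
    refine (measureReal_abs_sum_ge_le_of_mean_zero hlin_mem hlin0 hlinv (by positivity)).trans ?_
    rw [div_le_iff₀ (by positivity)]
    nlinarith [sq_nonneg (L / 80 - 2)]
  -- the norm
  set f : Fin n → ℝ → ℝ := fun i u => |G (T i u)| ^ p with hf
  have hfm : ∀ i, Measurable (f i) := fun i => ((hGm.comp (hTm i)).abs).pow_const p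
  have hφm : Measurable fun x : ℝ => |x| ^ p := measurable_id.abs.pow_const p
  have hf_bound : ∀ i, MemLp (f i) 2 uniformMeasure ∧
      ∫ u, f i u ∂uniformMeasure ≤ 5 / 4 * (1 / p) ∧
      ∫ u, f i u ^ 2 ∂uniformMeasure ≤ 5 / 4 * ((p + 1) / p ^ 2) := by
    intro i
    have hle : uniformMeasure.map (fun u => G (T i u)) ≤
        ENNReal.ofReal (5 / 4) • expPowMeasure p := by
      have h1 := Measure.map_mono (map_uniform_contract_le (hh5 i)) hGm
      rwa [Measure.map_map hGm (hTm i), Measure.map_smul, hGP.map_eq] at h1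
    have h2 : ∀ x : ℝ, (|x| ^ p) ^ 2 = |x| ^ (2 * p) := fun x => by
      rw [mul_comm 2 p, Real.rpow_mul (abs_nonneg _)]; norm_num
    have h3 := memLp_comp_and_integral_le_of_map_le (hGm.comp (hTm i)) (by norm_num) hle hφm
      (fun x => by positivity) (integrable_abs_rpow_expPow hp0 (by linarith))
      (memLp_two_abs_rpow_expPow hp0)
    rw [integral_abs_rpow_self_expPow hp0] at h3
    simp only [h2, integral_abs_rpow_two_mul_expPow hp0] at h3
    simp only [hf, h2]
    exact h3
  have hPnorm : P.real {x | 15 / 28 * n + 13 / 28 * n ≤ ∑ i, f i (x i)} ≤ 0.09 := by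
    refine (measureReal_sum_ge_le_of_mean (v := n * 0.766)
      (fun i => (hf_bound i).1) ?_ ?_ (by positivity)).trans ?_
    · have h1 : 5 / 4 * (1 / p) ≤ 15 / 28 := by
        rw [mul_one_div, div_le_iff₀ hp0]
        linarith
      refine (Finset.sum_le_sum fun i _ => ((hf_bound i).2.1.trans h1)).trans ?_
      simp [mul_comm]
    · have h1 : 5 / 4 * ((p + 1) / p ^ 2) ≤ 0.766 := by
        rw [← mul_div_assoc, div_le_iff₀ (by positivity)]
        nlinarith
      refine (Finset.sum_le_sum fun i _ => ((hf_bound i).2.2.trans h1)).trans ?_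
      simp
    · rw [div_le_iff₀ (by positivity)]
      nlinarith
  -- the displacement
  set D : Set (Fin n → ℝ) := {x | ∀ i, x i ∈ Set.Ioo (-1 : ℝ) 0 ∪ Set.Ioo 0 1} with hD
  have hDm : MeasurableSet D := by
    rw [hD, Set.ofPred_forall]
    exact MeasurableSet.iInter fun i =>
      (measurableSet_Ioo.union measurableSet_Ioo).preimage (measurable_pi_apply i)
  have hPD : P.real D = 1 := by
    have h1 : ∀ᵐ x ∂P, x ∈ D := by
      rw [hD]
      simp only [Set.mem_ofPred_eq]
      rw [Filter.eventually_all]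
      exact fun i => (Measure.quasiMeasurePreserving_eval _ i).ae ae_uniform_mem
    rw [measureReal_def, (prob_compl_eq_zero_iff hDm).mp h1, ENNReal.toReal_one]
  have hDabs : ∀ x ∈ D, ∀ i, |x i| < 1 := by
    intro x hx i
    rw [abs_lt]
    rcases hx i with h1 | h1 <;> constructor <;> linarith [h1.1, h1.2]
  set Z : (Fin n → ℝ) → ℝ := fun x => ∑ i, |b i| ^ p * (1 - |x i|) with hZ
  have hZm : Measurable Z := by rw [hZ]; fun_prop
  have hZhalf : 1 / 2 ≤ P.real (D ∩ {x | 0 ≤ Z x - 1 / 2}) := by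
    have hσ : MeasurePreserving (fun (x : Fin n → ℝ) i => flipHalves (x i)) P P :=
      measurePreserving_pi _ _ fun _ => measurePreserving_flipHalves
    have h1 := half_le_measureReal_inter_nonneg hσ hDm
      (by ext x; simp only [hD, Set.mem_preimage, Set.mem_ofPred_eq, flipHalves_mem_iff])
      (X := fun x => Z x - 1 / 2) (hZm.sub_const _) (fun x hx => by
        have h2 : ∀ i, |b i| ^ p * (1 - |flipHalves (x i)|) =
            |b i| ^ p - |b i| ^ p * (1 - |x i|) := fun i => by
          rw [(flipHalves_of_mem (hx i)).2]; ring
        rw [hZ]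
        simp only [h2, Finset.sum_sub_distrib, hb]
        ring)
    rw [hPD] at h1
    linarith
  -- assembling the event
  set X : (Fin n → ℝ) → ℝ := fun x => ∑ i, w i * G (x i) with hX
  have hXm : Measurable X := by
    rw [hX]
    exact Finset.measurable_sum _ fun i _ => (hGm.comp (measurable_pi_apply i)).const_mul _
  have hVm : Measurable fun x : Fin n → ℝ => ∑ i, f i (x i) :=
    Finset.measurable_sum _ fun i _ => (hfm i).comp (measurable_pi_apply i)
  have hlm : Measurable fun x : Fin n → ℝ => ∑ i, lin i (x i) :=
    Finset.measurable_sum _ fun i _ => (hlin_meas i).comp (measurable_pi_apply i)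
  have hm1 : MeasurableSet {x : Fin n → ℝ | c₁ ≤ |∑ i, lin i (x i)|} :=
    measurableSet_le measurable_const hlm.abs
  have hm2 : MeasurableSet {x | 0 ≤ Z x - 1 / 2} :=
    measurableSet_le measurable_const (hZm.sub_const _)
  set S : Set (Fin n → ℝ) := (D ∩ {x | 0 ≤ Z x - 1 / 2}) \
    {x | c₁ ≤ |∑ i, lin i (x i)|} with hS
  have hSm : MeasurableSet S := (hDm.inter hm2).diff hm1
  have hPS : 1 / 2 - 0.125 ≤ P.real S := by
    have h1 : P.real (D ∩ {x | 0 ≤ Z x - 1 / 2}) -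
        P.real {x | c₁ ≤ |∑ i, lin i (x i)|} ≤ P.real S := le_measureReal_sdiff
    linarith
  have hσ : MeasurePreserving (fun (x : Fin n → ℝ) i => -x i) P P :=
    measurePreserving_pi _ _ fun _ => measurePreserving_neg_uniform
  have hnegD : ∀ u : ℝ, -u ∈ Set.Ioo (-1 : ℝ) 0 ∪ Set.Ioo 0 1 ↔
      u ∈ Set.Ioo (-1 : ℝ) 0 ∪ Set.Ioo 0 1 := by
    intro u
    simp only [Set.mem_union, Set.mem_Ioo]
    constructor <;> rintro (h1 | h1)
    · exact Or.inr ⟨by linarith, by linarith⟩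
    · exact Or.inl ⟨by linarith, by linarith⟩
    · exact Or.inr ⟨by linarith, by linarith⟩
    · exact Or.inl ⟨by linarith, by linarith⟩
  have hσS : (fun (x : Fin n → ℝ) i => -x i) ⁻¹' S = S := by
    ext x
    simp only [hS, hD, hZ, Set.mem_preimage, Set.mem_sdiff, Set.mem_inter_iff, Set.mem_ofPred_eq,
      hnegD, hlin_odd, abs_neg, Finset.sum_neg_distrib]
  have hhalf := half_le_measureReal_inter_nonneg hσ hSm hσS (X := X) hXm (fun x hx => by
    rw [hX]
    simp only
    rw [← Finset.sum_neg_distrib]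
    refine Finset.sum_congr rfl fun i _ => ?_
    rw [hGodd _ (abs_lt.mp (hDabs x hx.1.1 i)), mul_neg])
  set E := (S ∩ {x | 0 ≤ X x}) \ {x | 15 / 28 * n + 13 / 28 * n ≤ ∑ i, f i (x i)} with hE
  have hPE : 0.07 ≤ P.real E := by
    have h1 : P.real (S ∩ {x | 0 ≤ X x}) -
        P.real {x | 15 / 28 * n + 13 / 28 * n ≤ ∑ i, f i (x i)} ≤ P.real E := le_measureReal_sdiff
    linarith
  refine ⟨R, hR0, ?_⟩
  refine (exp_neg_mul_const_ge (by omega) hPE).trans ?_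
  have hGpi : MeasurePreserving (fun (x : Fin n → ℝ) i => G (x i)) P
      (Measure.pi fun _ : Fin n => expPowMeasure p) := measurePreserving_pi _ _ fun _ => hGP
  have hXm' : Measurable fun x : Fin n → ℝ => ∑ i, w i * x i := by fun_prop
  have hVm' : Measurable fun x : Fin n → ℝ => ∑ i, |x i| ^ p := by fun_prop
  have hAm : MeasurableSet {x : Fin n → ℝ |
      p ^ (-(1 / p)) * t * R * W ≤ ∑ i, w i * x i ∧ ∑ i, |x i| ^ p ≤ R ^ p} :=
    (measurableSet_le measurable_const hXm').inter (measurableSet_le hVm' measurable_const)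
  rw [← hGpi.measureReal_preimage hAm.nullMeasurableSet]
  refine le_pi_of_transport (g := fun i u => 1 - lin i u) (T := T)
    (fun i => measurable_const.sub (hlin_meas i)) hTm
    (fun i u => ?_) (fun i => map_withDensity_uniform_contract (hh1 i))
    (hGpi.measurable hAm) ?_ ?_
  · have := (le_abs_self _).trans ((hlin_abs i u).trans (hh5 i))
    linarith
  · rintro x ⟨⟨⟨⟨hxD, hxZ⟩, -⟩, hxX⟩, hxV⟩
    simp only [Set.mem_ofPred_eq, not_le, hX, hZ] at hxZ hxX hxV
    constructor
    · have h1 : ∀ i, p ^ (-(1 / p)) * (β * W) * (|b i| ^ p * (1 - |x i|)) ≤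
          w i * G (T i (x i)) - w i * G (x i) := by
        intro i
        have h2 : w i * h i = β * W * |b i| ^ p := by
          rw [hh]
          simp only
          rw [mul_left_comm, hwb i]
          ring
        have h3 := mul_sub_le_mul_sub_contract hGincr (w := w i) (b := h i) (u := x i)
          (by rw [h2]; positivity) (hh1 i) (hDabs x hxD i)
        rw [h2] at h3
        rw [hT]
        simp only
        linarith
      have h4 := Finset.sum_le_sum fun i (_ : i ∈ Finset.univ) => h1 i
      rw [← Finset.mul_sum, Finset.sum_sub_distrib] at h4
      have h5 : p ^ (-(1 / p)) * (β * W) * (1 / 2) ≤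
          p ^ (-(1 / p)) * (β * W) * ∑ i, |b i| ^ p * (1 - |x i|) := by
        gcongr
        linarith
      have h6 : p ^ (-(1 / p)) * t * R * W = p ^ (-(1 / p)) * (β * W) * (1 / 2) := by
        rw [hβ]; ring
      rw [h6]
      linarith
    · rw [hRp]
      simp only [hf] at hxV
      linarith
  · rintro x ⟨⟨⟨-, hxl⟩, -⟩, -⟩
    simp only [Set.mem_ofPred_eq, not_le] at hxl
    have h1 : ∀ i, Real.exp (-(lin i (x i) + lin i (x i) ^ 2)) ≤ 1 - lin i (x i) := fun i =>
      exp_neg_sub_sq_le_one_sub ((hlin_abs i (x i)).trans (hh5 i))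
    refine le_trans ?_ (Finset.prod_le_prod (fun i _ => (Real.exp_nonneg _)) fun i _ => h1 i)
    rw [← Real.exp_sum, Finset.sum_neg_distrib, Finset.sum_add_distrib]
    refine Real.exp_le_exp.mpr (neg_le_neg ?_)
    have h2 : ∑ i, lin i (x i) ^ 2 ≤ L / 80 :=
      (Finset.sum_le_sum fun i _ => sq_le_sq.mpr (hlin_abs i (x i))).trans hh2
    have := le_abs_self (∑ i, lin i (x i))
    linarith

end TransportCase

section Main

variable {p : ℝ}

theorem sqrt_second_moment_mul_le (hp : 2 < p) {L : ℝ} (hL : 0 ≤ L) {m : ℝ} (hm : 0 < m) :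
    Real.sqrt ((∫ t, t ^ 2 ∂(expPowMeasure p)) / (160 * (2 : ℝ) ^ (2 / (p / (p - 1)))) * L / m) ≤
      p ^ (-(1 / p)) * Real.sqrt (L * 2 ^ (2 / p) / (640 * m)) := by
  have hp0 : 0 < p := by linarith
  have hI : ∫ t, t ^ 2 ∂(expPowMeasure p) ≤ p ^ (-(2 / p)) := by
    refine le_trans (le_of_eq ?_) (integral_abs_rpow_le_expPow hp0 two_pos.le hp.le)
    refine integral_congr_ae (Filter.Eventually.of_forall fun t => ?_)
    simp only
    rw [← sq_abs, ← Real.rpow_natCast]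
    norm_num
  have hpow : (2 : ℝ) ^ (2 / (p / (p - 1))) = 4 / 2 ^ (2 / p) := by
    rw [show 2 / (p / (p - 1)) = 2 - 2 / p by field_simp, Real.rpow_sub two_pos]
    norm_num
  have hsq : p ^ (-(1 / p)) = Real.sqrt (p ^ (-(2 / p))) := by
    rw [Real.sqrt_eq_rpow, ← Real.rpow_mul hp0.le]
    congr 1
    ring
  rw [hsq, ← Real.sqrt_mul (by positivity)]
  refine Real.sqrt_le_sqrt ?_
  rw [hpow]
  calc _ ≤ p ^ (-(2 / p)) / (160 * (4 / 2 ^ (2 / p))) * L / m := by gcongr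
    _ = _ := by field_simp; ring

theorem exists_scale_lower_bound (hp : 2 < p) {n : ℕ} (hn : 41 ≤ n)
    {w b : Fin n → ℝ} {W t : ℝ} (hW : 0 ≤ W) (hwb : ∀ i, w i * b i = W * |b i| ^ p)
    (hb : ∑ i, |b i| ^ p = 1) (ht0 : 0 ≤ t)
    (ht : t ^ 2 = Real.log n * 2 ^ (2 / p) / (640 * n)) :
    ∃ R > 0, 1 / 144 * (n : ℝ) ^ (-(1 : ℝ) / 40) ≤
      (Measure.pi fun _ : Fin n => expPowMeasure p).real
        {x | p ^ (-(1 / p)) * t * R * W ≤ ∑ i, w i * x i ∧ ∑ i, |x i| ^ p ≤ R ^ p} := by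
  rcases le_total p (7 / 3) with h | h
  · refine shift_lower_bound hp h hn ?_ hb ht0 ht
    simp only [hwb, ← Finset.mul_sum, hb, mul_one]
  · exact transport_lower_bound h hn hW hwb hb ht0 ht

theorem mul_le_div_rpow_of_sum_le (hp : 0 < p) {n : ℕ} {w x : Fin n → ℝ} {a R : ℝ} (ha : 0 < a)
    (hR : 0 < R) (h1 : a * R ≤ ∑ i, w i * x i) (h2 : ∑ i, |x i| ^ p ≤ R ^ p) :
    a ≤ (∑ i, w i * x i) / (∑ i, |x i| ^ p) ^ (1 / p) := by
  have hV0 : 0 ≤ ∑ i, |x i| ^ p := Finset.sum_nonneg fun i _ => by positivity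
  have hVpos : 0 < ∑ i, |x i| ^ p := by
    refine lt_of_le_of_ne hV0 fun h0 => ?_
    have h3 := (Finset.sum_eq_zero_iff_of_nonneg fun i _ => by positivity).mp h0.symm
    have h4 : ∑ i, w i * x i = 0 := Finset.sum_eq_zero fun i hi => by
      have h5 := (Real.rpow_eq_zero (abs_nonneg _) hp.ne').mp (h3 i hi)
      rw [abs_eq_zero.mp h5, mul_zero]
    have := mul_pos ha hR
    linarith
  rw [le_div_iff₀ (by positivity)]
  refine le_trans ?_ h1
  gcongr
  calc (∑ i, |x i| ^ p) ^ (1 / p) ≤ (R ^ p) ^ (1 / p) := by gcongr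
    _ = R := by rw [← Real.rpow_mul hR.le, mul_one_div_cancel hp.ne', Real.rpow_one]

end Main

/-- Khot–Naor probabilistic lemma (`L_q` case, `q ∈ (1,2)`): let `p ∈ (2,∞)`,
`q = p/(p−1)`, and let `ξ ∈ ℝ^n` have i.i.d. coordinates with density
`t ↦ p·exp(−|t|^p)/(2Γ(1/p))`.  With `δ₁ = E[ξ₁²]/(160·2^{2/q})`, for every `n ≥ 41`
and every `w ∈ ℝ^n`,
`Pr(⟨w,ξ⟩/‖ξ‖_p ≥ √(δ₁ log n / n)·‖w‖_q) ≥ (1/144)·n^{−1/40}`. -/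
theorem gaussian_like_inner_large_prob (p : ℝ) (hp : 2 < p) (n : ℕ) (hn : 41 ≤ n)
    (w : Fin n → ℝ) :
    let q : ℝ := p / (p - 1)
    let μ : Measure ℝ := volume.withDensity fun t =>
      ENNReal.ofReal (p * Real.exp (-(|t| ^ p)) / (2 * Real.Gamma (1 / p)))
    let δ₁ : ℝ := (∫ t, t ^ 2 ∂μ) / (160 * (2 : ℝ) ^ (2 / q))
    ENNReal.ofReal ((1 / 144 : ℝ) * (n : ℝ) ^ (-(1 : ℝ) / 40)) ≤
      Measure.pi (fun _ : Fin n => μ)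
        {ξ : Fin n → ℝ |
          Real.sqrt (δ₁ * Real.log n / n) * (∑ i, |w i| ^ q) ^ (1 / q) ≤
            (∑ i, w i * ξ i) / (∑ i, |ξ i| ^ p) ^ (1 / p)} := by
  intro q μ δ₁
  have hp0 : 0 < p := by linarith
  have hn0 : (41 : ℝ) ≤ n := by exact_mod_cast hn
  have hnpos : (0 : ℝ) < n := by linarith
  have hL0 : 0 < Real.log n := Real.log_pos (by linarith)
  have hμ : IsProbabilityMeasure μ := isProbabilityMeasure_expPow hp0
  have hpq : p.HolderConjugate q := Real.HolderConjugate.conjExponent (by linarith)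
  rcases eq_or_ne w 0 with rfl | hw
  · have h1 : (n : ℝ) ^ (-(1 : ℝ) / 40) ≤ 1 :=
      Real.rpow_le_one_of_one_le_of_nonpos (by linarith) (by norm_num)
    have h2 : (0 : ℝ) ^ q = 0 := Real.zero_rpow hpq.symm.ne_zero
    have h3 : (0 : ℝ) ^ (1 / q) = 0 := Real.zero_rpow (one_div_ne_zero hpq.symm.ne_zero)
    simp only [Pi.zero_apply, abs_zero, h2, Finset.sum_const_zero, h3, mul_zero, zero_mul,
      zero_div, le_refl, Set.ofPred_true, measure_univ]
    rw [ENNReal.ofReal_le_one]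
    linarith
  obtain ⟨hW, b, hb, hwb⟩ := exists_lp_dual_vector hpq hw
  set W := (∑ i, |w i| ^ q) ^ (1 / q) with hWdef
  have hrad : 0 < Real.log n * 2 ^ (2 / p) / (640 * n) := by positivity
  set t := Real.sqrt (Real.log n * 2 ^ (2 / p) / (640 * n)) with ht
  have ht0 : 0 < t := Real.sqrt_pos.mpr hrad
  obtain ⟨R, hR, hmain⟩ := exists_scale_lower_bound hp hn hW.le hwb hb ht0.le
    (Real.sq_sqrt hrad.le)
  refine (ENNReal.ofReal_le_ofReal hmain).trans ?_
  refine (ofReal_measureReal (measure_ne_top (Measure.pi fun _ : Fin n => μ) _)).le.trans ?_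
  refine measure_mono fun x hx => ?_
  obtain ⟨hx1, hx2⟩ := hx
  have hδ : Real.sqrt (δ₁ * Real.log n / n) ≤ p ^ (-(1 / p)) * t :=
    sqrt_second_moment_mul_le hp hL0.le hnpos
  exact (mul_le_mul_of_nonneg_right hδ hW.le).trans
    (mul_le_div_rpow_of_sum_le hp0 (by positivity) hR (by linarith) hx2)
end

section
/- Let n ≥ 2 be an integer, let N be any norm on ℝ^n, and set D = sup{ N(x) : x ∈ ℝ^n, ‖x‖_∞ ≤ 1 }. Let M = ⌈72·(ln 2)·n^{1/48}⌉ and let ζ^1,…,ζ^M be independent random vectors, each uniformly distributed on {−1,1}^n. Then Pr( √((log n)/(48·n)) · D ≤ max_{1≤i≤M} N(ζ^i) ≤ D ) ≥ 1/2. -/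
open scoped ENNReal

/-- The `L_p` norm of a vector `x ∈ ℝ^ι`, for `p ∈ [1,∞]` (for `p = ∞`, the max norm). -/
noncomputable def lpNorm {ι : Type*} [Fintype ι] (p : ℝ≥0∞) (x : ι → ℝ) : ℝ :=
  if p = ∞ then ⨆ i, |x i| else (∑ i, |x i| ^ p.toReal) ^ (1 / p.toReal)

/-- The sign `±1` encoded by a Boolean. -/
noncomputable def boolSign (b : Bool) : ℝ := if b then 1 else -1

section SignSums

variable {ι : Type*} [Fintype ι] [DecidableEq ι]

lemma sum_prod_bool (f : ι → Bool → ℝ) :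
    ∑ ζ : ι → Bool, ∏ i, f i (ζ i) = ∏ i, (f i true + f i false) := by
  have h := Finset.prod_univ_sum (fun _ : ι => (Finset.univ : Finset Bool)) f
  simp only [Fintype.piFinset_univ, Fintype.sum_bool] at h
  exact h.symm

variable {p d : ι → Bool → ℝ}

lemma sum_prod_weight (hp : ∀ i, p i true + p i false = 1) :
    ∑ ζ : ι → Bool, ∏ i, p i (ζ i) = 1 := by
  rw [sum_prod_bool]
  simp [hp]

lemma sum_prod_weight_mul (hp : ∀ i, p i true + p i false = 1) (j : ι) (g : Bool → ℝ) :
    ∑ ζ : ι → Bool, (∏ i, p i (ζ i)) * g (ζ j) = p j true * g true + p j false * g false := by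
  have h := sum_prod_bool fun i b => p i b * if i = j then g b else 1
  have hl : ∀ ζ : ι → Bool, ∏ i, (p i (ζ i) * if i = j then g (ζ i) else 1) =
      (∏ i, p i (ζ i)) * g (ζ j) := fun ζ => by
    rw [Finset.prod_mul_distrib, Finset.prod_ite_eq' Finset.univ j fun i => g (ζ i)]
    simp
  simp only [hl] at h
  rw [h, Finset.prod_eq_single j]
  · simp
  · intro i _ hi
    simp [hi, hp]
  · simp

lemma sum_prod_weight_mul_mul_of_ne (hp : ∀ i, p i true + p i false = 1)
    (hd : ∀ i, p i true * d i true + p i false * d i false = 0) {j k : ι} (hjk : j ≠ k) :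
    ∑ ζ : ι → Bool, (∏ i, p i (ζ i)) * (d j (ζ j) * d k (ζ k)) = 0 := by
  have h := sum_prod_bool fun i b =>
    p i b * ((if i = j then d i b else 1) * if i = k then d i b else 1)
  have hl : ∀ ζ : ι → Bool, ∏ i, (p i (ζ i) *
      ((if i = j then d i (ζ i) else 1) * if i = k then d i (ζ i) else 1)) =
      (∏ i, p i (ζ i)) * (d j (ζ j) * d k (ζ k)) := fun ζ => by
    rw [Finset.prod_mul_distrib, Finset.prod_mul_distrib,
      Finset.prod_ite_eq' Finset.univ j fun i => d i (ζ i),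
      Finset.prod_ite_eq' Finset.univ k fun i => d i (ζ i)]
    simp
  simp only [hl] at h
  rw [h]
  refine Finset.prod_eq_zero (Finset.mem_univ j) ?_
  simpa [hjk] using hd j

lemma sum_prod_weight_mul_sum (hp : ∀ i, p i true + p i false = 1)
    (hd : ∀ i, p i true * d i true + p i false * d i false = 0) :
    ∑ ζ : ι → Bool, (∏ i, p i (ζ i)) * ∑ i, d i (ζ i) = 0 := by
  simp only [Finset.mul_sum]
  rw [Finset.sum_comm]
  exact Finset.sum_eq_zero fun j _ => by rw [sum_prod_weight_mul hp, hd]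

lemma sum_prod_weight_mul_sum_sq (hp : ∀ i, p i true + p i false = 1)
    (hd : ∀ i, p i true * d i true + p i false * d i false = 0) :
    ∑ ζ : ι → Bool, (∏ i, p i (ζ i)) * (∑ i, d i (ζ i)) ^ 2 =
      ∑ i, (p i true * d i true ^ 2 + p i false * d i false ^ 2) := by
  simp only [sq]
  simp only [Finset.sum_mul_sum]
  simp only [Finset.mul_sum]
  rw [Finset.sum_comm]
  refine Finset.sum_congr rfl fun j _ => ?_
  rw [Finset.sum_comm, Finset.sum_eq_single j]
  · exact sum_prod_weight_mul hp j fun b => d j b * d j b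
  · exact fun k _ hk => sum_prod_weight_mul_mul_of_ne hp hd hk.symm
  · simp

/-- The Rademacher sum `∑ wᵢ ζᵢ`. -/
noncomputable def signSum (w : ι → ℝ) (ζ : ι → Bool) : ℝ := ∑ i, w i * boolSign (ζ i)

lemma sum_signSum_sq (w : ι → ℝ) :
    ∑ ζ : ι → Bool, signSum w ζ ^ 2 = 2 ^ Fintype.card ι * ∑ i, w i ^ 2 := by
  have h := sum_prod_weight_mul_sum_sq (p := fun (_ : ι) _ => (1 / 2 : ℝ))
    (d := fun i b => w i * boolSign b) (by intro; norm_num) (by intro; simp [boolSign])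
  simp only [Finset.prod_const, Finset.card_univ, ← Finset.mul_sum] at h
  have h2 : ∑ ζ : ι → Bool, signSum w ζ ^ 2 =
      2 ^ Fintype.card ι * ((1 / 2) ^ Fintype.card ι * ∑ ζ : ι → Bool, signSum w ζ ^ 2) := by
    rw [← mul_assoc, ← mul_pow]; norm_num
  rw [h2]
  unfold signSum
  rw [h]
  congr 1
  exact Finset.sum_congr rfl fun i _ => by simp [boolSign]; ring

lemma sum_exp_signSum (w : ι → ℝ) :
    ∑ ζ : ι → Bool, Real.exp (signSum w ζ) = 2 ^ Fintype.card ι * ∏ i, Real.cosh (w i) := by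
  have h := sum_prod_bool fun (i : ι) b => Real.exp (w i * boolSign b)
  simp only [← Real.exp_sum] at h
  unfold signSum
  rw [h, ← Finset.card_univ, ← Finset.prod_const, ← Finset.prod_mul_distrib]
  refine Finset.prod_congr rfl fun i _ => ?_
  rw [Real.cosh_eq]; simp [boolSign]; ring

lemma sum_neg_signSum (w : ι → ℝ) (f : ℝ → ℝ) :
    ∑ ζ : ι → Bool, f (-signSum w ζ) = ∑ ζ : ι → Bool, f (signSum w ζ) := by
  let e : (ι → Bool) ≃ (ι → Bool) := Equiv.arrowCongr (Equiv.refl ι) Equiv.boolNot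
  refine Fintype.sum_equiv e _ _ fun ζ => ?_
  congr 1
  simp only [signSum, ← Finset.sum_neg_distrib]
  refine Finset.sum_congr rfl fun i _ => ?_
  cases h : ζ i <;> simp [e, boolSign, h]

/-- Exponential tilting: the lower tail bound obtained by testing the indicator of `[m - 1, ∞)`
against an exponential times a quadratic, `m` being the tilted mean. -/
lemma card_signSum_ge_of_tilt (w : ι → ℝ) (hw : ∑ i, w i ^ 2 ≤ 1) {l : ℝ} (hl : 0 ≤ l) {t : ℝ}
    (ht : t ≤ ∑ i, w i * Real.tanh (l * w i) - 1) :
    2 ^ Fintype.card ι * (1 / 2 * Real.exp (-(l * (∑ i, w i * Real.tanh (l * w i) + 1))) *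
      ∏ i, Real.cosh (l * w i)) ≤
      ∑ ζ : ι → Bool, if t ≤ signSum w ζ then (1 : ℝ) else 0 := by
  set m := ∑ i, w i * Real.tanh (l * w i) with hm
  set K := ∏ i, Real.cosh (l * w i) with hK
  have hKpos : 0 < K := Finset.prod_pos fun i _ => Real.cosh_pos _
  let p : ι → Bool → ℝ := fun i b => Real.exp (l * w i * boolSign b) / (2 * Real.cosh (l * w i))
  let d : ι → Bool → ℝ := fun i b => w i * (boolSign b - Real.tanh (l * w i))
  have hp : ∀ i, p i true + p i false = 1 := fun i => by
    have := Real.cosh_pos (l * w i)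
    have h2 := Real.cosh_eq (l * w i)
    simp only [p, boolSign]
    simp
    field_simp
    linarith
  have hc : ∀ i, p i true - p i false = Real.tanh (l * w i) := fun i => by
    have := Real.cosh_pos (l * w i)
    have h2 := Real.sinh_eq (l * w i)
    rw [Real.tanh_eq_sinh_div_cosh]
    simp only [p, boolSign]
    simp
    field_simp
    linarith
  have hd : ∀ i, p i true * d i true + p i false * d i false = 0 := fun i => by
    have h1 : p i true * d i true + p i false * d i false =
      w i * ((p i true - p i false) - Real.tanh (l * w i) * (p i true + p i false)) := by
      simp only [d, boolSign]; simp; ring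
    rw [h1, hp, hc]; ring
  have hv : ∀ i, p i true * d i true ^ 2 + p i false * d i false ^ 2 ≤ w i ^ 2 := fun i => by
    have h1 : p i true * d i true ^ 2 + p i false * d i false ^ 2 =
      w i ^ 2 * ((1 + Real.tanh (l * w i) ^ 2) * (p i true + p i false)
        - 2 * Real.tanh (l * w i) * (p i true - p i false)) := by
      simp only [d, boolSign]; simp; ring
    rw [h1, hp, hc]
    nlinarith [mul_nonneg (sq_nonneg (w i)) (sq_nonneg (Real.tanh (l * w i)))]
  have hvar := (Finset.sum_le_sum fun i (_ : i ∈ Finset.univ) => hv i).trans hw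
  rw [← sum_prod_weight_mul_sum_sq hp hd] at hvar
  have hmean := sum_prod_weight_mul_sum hp hd
  have hone := sum_prod_weight hp
  have hX : ∀ ζ : ι → Bool, ∑ i, d i (ζ i) = signSum w ζ - m := fun ζ => by
    simp only [d, signSum, hm, mul_sub, Finset.sum_sub_distrib]
  have hP : ∀ ζ : ι → Bool, 2 ^ Fintype.card ι * K * ∏ i, p i (ζ i) =
      Real.exp (l * signSum w ζ) := fun ζ => by
    have h1 : l * signSum w ζ = ∑ i, l * w i * boolSign (ζ i) := by
      simp [signSum, Finset.mul_sum, mul_assoc]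
    rw [h1, Real.exp_sum, ← Finset.card_univ, ← Finset.prod_const, hK, ← Finset.prod_mul_distrib,
      ← Finset.prod_mul_distrib]
    refine Finset.prod_congr rfl fun i _ => ?_
    have := Real.cosh_pos (l * w i)
    simp only [p]
    field_simp
  set W : (ι → Bool) → ℝ := fun ζ => ∏ i, p i (ζ i) with hW
  have hWn : ∀ ζ, 0 ≤ W ζ := fun ζ => Finset.prod_nonneg fun i _ =>
    div_nonneg (Real.exp_pos _).le (by have := Real.cosh_pos (l * w i); positivity)
  have hpt : ∀ ζ : ι → Bool, 2 ^ Fintype.card ι * K * Real.exp (-(l * (m + 1))) *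
      (W ζ * (1 / 2 * ((1 + (signSum w ζ - m)) - (l + 1 / 2) * ((signSum w ζ - m) ^ 2 - 1)))) ≤
      if t ≤ signSum w ζ then (1 : ℝ) else 0 := fun ζ => by
    set y := signSum w ζ - m with hy
    have h1 : 2 ^ Fintype.card ι * K * Real.exp (-(l * (m + 1))) * (W ζ *
        (1 / 2 * ((1 + y) - (l + 1 / 2) * (y ^ 2 - 1)))) =
        Real.exp (l * (y - 1)) * (1 / 2 * ((1 + y) * (1 - (l + 1 / 2) * (y - 1)))) := by
      have h2 : l * (y - 1) = l * signSum w ζ + -(l * (m + 1)) := by rw [hy]; ring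
      rw [h2, Real.exp_add, ← hP ζ]
      ring
    rw [h1]
    split_ifs with h
    · have h3 : 1 / 2 * ((1 + y) * (1 - (l + 1 / 2) * (y - 1))) ≤ Real.exp (-(l * (y - 1))) := by
        have := Real.add_one_le_exp (-(l * (y - 1)))
        nlinarith [mul_nonneg (show 0 ≤ l + 1 / 2 by linarith) (sq_nonneg (y - 1))]
      calc _ ≤ Real.exp (l * (y - 1)) * Real.exp (-(l * (y - 1))) := by gcongr
        _ = 1 := by rw [← Real.exp_add]; simp
    · have h3 : y < -1 := by linarith
      refine mul_nonpos_of_nonneg_of_nonpos (Real.exp_pos _).le ?_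
      have : 0 ≤ 1 - (l + 1 / 2) * (y - 1) := by nlinarith
      nlinarith
  refine le_trans ?_ (Finset.sum_le_sum fun ζ _ => hpt ζ)
  rw [← Finset.mul_sum]
  have hsum : 1 / 2 ≤ ∑ ζ, W ζ *
      (1 / 2 * ((1 + (signSum w ζ - m)) - (l + 1 / 2) * ((signSum w ζ - m) ^ 2 - 1))) := by
    simp only [hX] at hmean hvar
    have h1 : ∑ ζ, W ζ *
      (1 / 2 * ((1 + (signSum w ζ - m)) - (l + 1 / 2) * ((signSum w ζ - m) ^ 2 - 1))) =
      (1 / 2 + 1 / 2 * (l + 1 / 2)) * ∑ ζ, W ζ + 1 / 2 * ∑ ζ, W ζ * (signSum w ζ - m)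
      - 1 / 2 * (l + 1 / 2) * ∑ ζ, W ζ * (signSum w ζ - m) ^ 2 := by
      simp only [Finset.mul_sum, ← Finset.sum_add_distrib, ← Finset.sum_sub_distrib]
      exact Finset.sum_congr rfl fun ζ _ => by ring
    rw [h1, hone, hmean]
    nlinarith
  have hpos : 0 < 2 ^ Fintype.card ι * K * Real.exp (-(l * (m + 1))) := by positivity
  calc _ = 2 ^ Fintype.card ι * K * Real.exp (-(l * (m + 1))) * (1 / 2) := by ring
    _ ≤ _ := by gcongr

lemma exp_sub_sq_le_cosh (x : ℝ) : Real.exp (x ^ 2 / 2 - x ^ 4 / 4) ≤ Real.cosh x := by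
  have h1 : 1 + x ^ 2 / 2 ≤ Real.cosh x := by
    have := sum_le_hasSum (Finset.range 2)
      (fun k _ => by rw [pow_mul]; positivity) (Real.hasSum_cosh x)
    simpa [Finset.sum_range_succ] using this
  have h2 : Real.exp (x ^ 2 / 2 - x ^ 4 / 4) ≤ 1 + x ^ 2 / 2 := by
    have hz : 0 ≤ x ^ 2 / 2 := by positivity
    have h3 := Real.add_one_le_exp (-(x ^ 2 / 2 - x ^ 4 / 4))
    rw [Real.exp_neg] at h3
    by_cases h4 : x ^ 2 / 2 ≤ 1
    · have h5 : (1 + x ^ 2 / 2)⁻¹ ≤ -(x ^ 2 / 2 - x ^ 4 / 4) + 1 := by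
        rw [inv_le_iff_one_le_mul₀ (by linarith)]
        nlinarith [mul_nonneg hz (sq_nonneg (x ^ 2))]
      exact (inv_le_inv₀ (by linarith) (Real.exp_pos _)).1 (h5.trans h3)
    · have h5 : Real.exp (x ^ 2 / 2 - x ^ 4 / 4) ≤ 1 := Real.exp_le_one_iff.2 (by nlinarith)
      linarith
  exact h2.trans h1

lemma pow_four_le_cosh (x : ℝ) : x ^ 4 ≤ 24 * Real.cosh x - 24 - 12 * x ^ 2 := by
  have := sum_le_hasSum (Finset.range 3)
    (fun k _ => by rw [pow_mul]; positivity) (Real.hasSum_cosh x)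
  simp [Finset.sum_range_succ, Nat.factorial] at this
  linarith

lemma mul_tanh_le_sq (x : ℝ) : x * Real.tanh x ≤ x ^ 2 := by
  wlog hx : 0 ≤ x generalizing x
  · simpa using this (-x) (by linarith)
  have hmono : MonotoneOn (fun y : ℝ => y * Real.cosh y - Real.sinh y) (Set.Ici 0) := by
    refine monotoneOn_of_hasDerivWithinAt_nonneg (convex_Ici 0) (by fun_prop)
      (f' := fun y => y * Real.sinh y) (fun y _ => ?_) (fun y hy => ?_)
    · have h := ((hasDerivAt_id y).mul (Real.hasDerivAt_cosh y)).sub (Real.hasDerivAt_sinh y)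
      refine HasDerivAt.hasDerivWithinAt (h.congr_deriv ?_)
      simp
    · rw [interior_Ici] at hy
      exact mul_nonneg (le_of_lt hy) (Real.sinh_nonneg_iff.2 (le_of_lt hy))
  have h := hmono Set.self_mem_Ici hx hx
  simp only [zero_mul, Real.sinh_zero, sub_zero] at h
  have hc := Real.cosh_pos x
  have : Real.tanh x ≤ x := by
    rw [Real.tanh_eq_sinh_div_cosh, div_le_iff₀ hc]
    linarith
  nlinarith

lemma sq_sub_le_mul_tanh (x : ℝ) : x ^ 2 - x ^ 4 / 2 ≤ x * Real.tanh x := by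
  wlog hx : 0 ≤ x generalizing x
  · simpa [Even.neg_pow (by decide : Even 4)] using this (-x) (by linarith)
  have hc := Real.cosh_pos x
  have h1 : x * (1 - x ^ 2 / 2) ≤ Real.tanh x := by
    rw [Real.tanh_eq_sinh_div_cosh, le_div_iff₀ hc]
    refine le_trans ?_ (Real.self_le_sinh_iff.2 hx)
    rw [mul_assoc]
    refine mul_le_of_le_one_right hx ?_
    by_cases h : 1 - x ^ 2 / 2 ≤ 0
    · exact (mul_nonpos_of_nonpos_of_nonneg h hc.le).trans zero_le_one
    · have h2 := Real.add_one_le_exp (-(x ^ 2 / 2))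
      calc (1 - x ^ 2 / 2) * Real.cosh x ≤ Real.exp (-(x ^ 2 / 2)) * Real.exp (x ^ 2 / 2) := by
            have := Real.cosh_le_exp_half_sq x
            gcongr
            linarith
        _ = 1 := by rw [← Real.exp_add]; simp
  nlinarith

/-- An anticoncentration bound of Paley–Zygmund type for a normalized Rademacher sum. -/
lemma card_signSum_sq_ge (w : ι → ℝ) (hw : ∑ i, w i ^ 2 = 1) :
    2 ^ Fintype.card ι * (1 / 72) ≤
      ∑ ζ : ι → Bool, if 3 / 4 ≤ signSum w ζ ^ 2 then (1 : ℝ) else 0 := by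
  have hexp : ∑ ζ : ι → Bool, Real.exp (signSum w ζ) ≤ 2 ^ Fintype.card ι * 1.65 := by
    rw [sum_exp_signSum]
    gcongr
    calc ∏ i, Real.cosh (w i) ≤ ∏ i, Real.exp (w i ^ 2 / 2) :=
          Finset.prod_le_prod (fun i _ => (Real.cosh_pos _).le)
            fun i _ => Real.cosh_le_exp_half_sq _
      _ = Real.exp (1 / 2) := by rw [← Real.exp_sum, ← Finset.sum_div, hw]
      _ ≤ 1.65 := by
          have h1 : Real.exp (1 / 2) ^ 2 = Real.exp 1 := by
            rw [← Real.exp_nat_mul]; norm_num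
          have h2 := Real.exp_one_lt_d9
          nlinarith [Real.exp_pos (1 / 2)]
  have hcosh : ∑ ζ : ι → Bool, Real.cosh (signSum w ζ) ≤ 2 ^ Fintype.card ι * 1.65 := by
    have h := sum_neg_signSum w Real.exp
    simp only [Real.cosh_eq]
    rw [← Finset.sum_div, Finset.sum_add_distrib, h]
    linarith
  have hsq := sum_signSum_sq w
  rw [hw, mul_one] at hsq
  have hpt : ∀ ζ : ι → Bool, (1 / 113 : ℝ) * (22.75 * signSum w ζ ^ 2 - 16.5 -
      (24 * Real.cosh (signSum w ζ) - 24 - 12 * signSum w ζ ^ 2)) ≤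
      if 3 / 4 ≤ signSum w ζ ^ 2 then (1 : ℝ) else 0 := fun ζ => by
    have h := pow_four_le_cosh (signSum w ζ)
    split_ifs with hc
    · nlinarith [sq_nonneg (signSum w ζ ^ 2 - 22.75 / 2)]
    · nlinarith [sq_nonneg (signSum w ζ)]
  refine le_trans ?_ (Finset.sum_le_sum fun ζ _ => hpt ζ)
  have h1 : ∑ ζ : ι → Bool, (1 / 113 : ℝ) * (22.75 * signSum w ζ ^ 2 - 16.5 -
      (24 * Real.cosh (signSum w ζ) - 24 - 12 * signSum w ζ ^ 2)) =
      (1 / 113 : ℝ) * (34.75 * ∑ ζ : ι → Bool, signSum w ζ ^ 2 + 7.5 * ∑ _ζ : ι → Bool, (1 : ℝ) -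
      24 * ∑ ζ : ι → Bool, Real.cosh (signSum w ζ)) := by
    simp only [Finset.mul_sum, ← Finset.sum_add_distrib, ← Finset.sum_sub_distrib]
    exact Finset.sum_congr rfl fun ζ _ => by ring
  have h2 : ∑ _ζ : ι → Bool, (1 : ℝ) = 2 ^ Fintype.card ι := by simp
  rw [h1, h2, hsq]
  have : (0 : ℝ) < 2 ^ Fintype.card ι := by positivity
  linarith

/-- A Gaussian-type lower tail bound for normalized Rademacher sums with small coefficients. -/
lemma card_signSum_ge_of_small (w : ι → ℝ) (hw : ∑ i, w i ^ 2 = 1) {e l t : ℝ}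
    (he : ∀ i, w i ^ 2 ≤ e) (hl : 0 < l) (ht : t ≤ l - l ^ 3 * e / 2 - 1) :
    2 ^ Fintype.card ι * (1 / 2 * Real.exp (-(l ^ 2 / 2) - l - l ^ 4 * e / 4)) ≤
      ∑ ζ : ι → Bool, if t ≤ signSum w ζ then (1 : ℝ) else 0 := by
  set m := ∑ i, w i * Real.tanh (l * w i) with hm
  have hlm : l * m = ∑ i, l * w i * Real.tanh (l * w i) := by
    simp [hm, Finset.mul_sum, mul_assoc]
  have hw4 : ∑ i, w i ^ 4 ≤ e := by
    calc ∑ i, w i ^ 4 ≤ ∑ i, e * w i ^ 2 :=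
          Finset.sum_le_sum fun i _ => by nlinarith [he i, sq_nonneg (w i)]
      _ = e := by rw [← Finset.mul_sum, hw, mul_one]
  have hm1 : l * m ≤ l ^ 2 := by
    calc l * m ≤ ∑ i, l ^ 2 * w i ^ 2 := by
          rw [hlm]
          exact Finset.sum_le_sum fun i _ => (mul_tanh_le_sq _).trans_eq (mul_pow _ _ _)
      _ = l ^ 2 := by rw [← Finset.mul_sum, hw, mul_one]
  have hm2 : l ^ 2 - l ^ 4 * e / 2 ≤ l * m := by
    calc l ^ 2 - l ^ 4 * e / 2 ≤ l ^ 2 * ∑ i, w i ^ 2 - l ^ 4 / 2 * ∑ i, w i ^ 4 := by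
          rw [hw]
          nlinarith [pow_pos hl 4]
      _ = ∑ i, ((l * w i) ^ 2 - (l * w i) ^ 4 / 2) := by
          simp only [Finset.mul_sum, ← Finset.sum_sub_distrib]
          exact Finset.sum_congr rfl fun i _ => by ring
      _ ≤ l * m := by
          rw [hlm]
          exact Finset.sum_le_sum fun i _ => sq_sub_le_mul_tanh _
  have hm3 : l - l ^ 3 * e / 2 ≤ m := by
    refine le_of_mul_le_mul_left ?_ hl
    linarith [show l * (l - l ^ 3 * e / 2) = l ^ 2 - l ^ 4 * e / 2 by ring]
  have hprod : Real.exp (l ^ 2 / 2 - l ^ 4 * e / 4) ≤ ∏ i, Real.cosh (l * w i) := by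
    calc Real.exp (l ^ 2 / 2 - l ^ 4 * e / 4)
        ≤ Real.exp (l ^ 2 / 2 * ∑ i, w i ^ 2 - l ^ 4 / 4 * ∑ i, w i ^ 4) := by
          rw [hw]
          refine Real.exp_le_exp.2 ?_
          nlinarith [pow_pos hl 4]
      _ = ∏ i, Real.exp ((l * w i) ^ 2 / 2 - (l * w i) ^ 4 / 4) := by
          rw [← Real.exp_sum]
          congr 1
          simp only [Finset.mul_sum, ← Finset.sum_sub_distrib]
          exact Finset.sum_congr rfl fun i _ => by ring
      _ ≤ _ := Finset.prod_le_prod (fun i _ => (Real.exp_pos _).le)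
          fun i _ => exp_sub_sq_le_cosh _
  refine le_trans ?_ (card_signSum_ge_of_tilt w hw.le hl.le (ht.trans (by linarith)))
  refine mul_le_mul_of_nonneg_left ?_ (by positivity)
  calc 1 / 2 * Real.exp (-(l ^ 2 / 2) - l - l ^ 4 * e / 4)
      = 1 / 2 * Real.exp (-(l ^ 2 + l)) * Real.exp (l ^ 2 / 2 - l ^ 4 * e / 4) := by
        rw [mul_assoc, ← Real.exp_add]; ring_nf
    _ ≤ _ := by
        gcongr
        linarith

/-- The upper tail of a Rademacher sum restricted to a subset of the coefficients is at most the
two-sided tail of the whole sum. -/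
lemma card_signSum_ge_le_card_abs (u : ι → ℝ) (s : Finset ι) (t : ℝ) :
    (∑ ζ : ι → Bool, if t ≤ signSum (fun i => if i ∈ s then u i else 0) ζ then (1 : ℝ) else 0) ≤
      ∑ ζ : ι → Bool, if t ≤ |signSum u ζ| then (1 : ℝ) else 0 := by
  set a := fun ζ : ι → Bool => signSum (fun i => if i ∈ s then u i else 0) ζ with ha
  set b := fun ζ : ι → Bool => signSum (fun i => if i ∈ s then 0 else u i) ζ with hb
  have hab : ∀ ζ, signSum u ζ = a ζ + b ζ := fun ζ => by
    simp only [ha, hb, signSum, ← Finset.sum_add_distrib]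
    refine Finset.sum_congr rfl fun i _ => ?_
    split_ifs <;> ring
  let e : (ι → Bool) ≃ (ι → Bool) :=
    Equiv.piCongrRight fun i => if i ∈ s then Equiv.refl Bool else Equiv.boolNot
  have hflip : ∑ ζ : ι → Bool, (if t ≤ |a ζ - b ζ| then (1 : ℝ) else 0) =
      ∑ ζ : ι → Bool, if t ≤ |signSum u ζ| then (1 : ℝ) else 0 := by
    refine Fintype.sum_equiv e _ _ fun ζ => ?_
    have : signSum u (e ζ) = a ζ - b ζ := by
      simp only [ha, hb, signSum, ← Finset.sum_sub_distrib]
      refine Finset.sum_congr rfl fun i _ => ?_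
      by_cases h : i ∈ s
      · simp [e, h]
      · cases h2 : ζ i <;> simp [e, h, h2, boolSign]
    rw [this]
  have hneg := sum_neg_signSum (fun i => if i ∈ s then u i else 0)
    fun x => if t ≤ x then (1 : ℝ) else 0
  have hsum : ∑ ζ : ι → Bool, ((if t ≤ a ζ then (1 : ℝ) else 0) + if t ≤ -a ζ then 1 else 0) ≤
      ∑ ζ : ι → Bool, ((if t ≤ |signSum u ζ| then (1 : ℝ) else 0) +
        if t ≤ |a ζ - b ζ| then 1 else 0) := by
    refine Finset.sum_le_sum fun ζ _ => ?_
    rw [hab]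
    have h1 := le_abs_self (a ζ + b ζ)
    have h2 := neg_le_abs (a ζ + b ζ)
    have h3 := le_abs_self (a ζ - b ζ)
    have h4 := neg_le_abs (a ζ - b ζ)
    split_ifs <;> first | (exfalso; linarith) | norm_num
  rw [Finset.sum_add_distrib, Finset.sum_add_distrib, hflip] at hsum
  simp only [ha] at hsum ⊢
  linarith

/-- The numerical estimate comparing the tail bound at a level near `√T` with `exp (-T)`. -/
lemma exp_neg_div_le_tail {t e : ℝ} (ht : 0.86 ≤ t) (he0 : 0 ≤ e) (he : e ≤ 0.000000005 / t ^ 8) :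
    Real.exp (-t ^ 2) / 72 ≤
      1 / 2 * Real.exp (-((t + 1.01) ^ 2 / 2) - (t + 1.01) - (t + 1.01) ^ 4 * e / 4) := by
  have hl : t + 1.01 ≤ 2.2 * t := by linarith
  have ht4 : (0.5 : ℝ) ≤ t ^ 4 := by
    calc (0.5 : ℝ) ≤ 0.86 ^ 4 := by norm_num
      _ ≤ t ^ 4 := by gcongr
  have h1 : (t + 1.01) ^ 4 * e / 4 ≤ 0.000001 := by
    calc (t + 1.01) ^ 4 * e / 4 ≤ (2.2 * t) ^ 4 * (0.000000005 / t ^ 8) / 4 := by gcongr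
      _ = 2.2 ^ 4 * 0.000000005 / 4 / t ^ 4 := by
          have : t ≠ 0 := by linarith
          field_simp
      _ ≤ 0.000001 := by
          rw [div_le_iff₀ (by linarith)]
          linarith
  have h2 : Real.exp 3.55 ≤ 36 := by
    have h3 : Real.exp 3.55 ^ 20 = Real.exp 1 ^ 71 := by
      rw [← Real.exp_nat_mul, ← Real.exp_nat_mul]; norm_num
    have h4 : Real.exp 1 ^ 71 ≤ 36 ^ 20 := by
      calc Real.exp 1 ^ 71 ≤ 2.7182818286 ^ 71 := by
            have := Real.exp_one_lt_d9
            gcongr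
        _ ≤ 36 ^ 20 := by norm_num
    exact (pow_le_pow_iff_left₀ (Real.exp_pos _).le (by norm_num) (by norm_num)).1 (h3.trans_le h4)
  have h5 : Real.exp (-t ^ 2) ≤
      Real.exp 3.55 * Real.exp (-((t + 1.01) ^ 2 / 2) - (t + 1.01) - (t + 1.01) ^ 4 * e / 4) := by
    rw [← Real.exp_add]
    refine Real.exp_le_exp.2 ?_
    nlinarith [sq_nonneg (t - 2.01)]
  have h6 := Real.exp_pos (-((t + 1.01) ^ 2 / 2) - (t + 1.01) - (t + 1.01) ^ 4 * e / 4)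
  nlinarith

/-- The coefficients of size at most `exp (-12 T)` already carry almost a unit of `ℓ²` mass. -/
lemma sqrt_sum_sq_small_ge (u : ι → ℝ) {T : ℝ} (hT : 3 / 4 ≤ T)
    (hcard : (Fintype.card ι : ℝ) = Real.exp (12 * T) ^ 4)
    (hu : ∑ i, |u i| = Real.exp (12 * T) ^ 2) (hQ : ∑ i, u i ^ 2 ≤ 4 / 3 * T)
    (hE : 14400 * T ^ 2 ≤ Real.exp (12 * T)) :
    1 - 1 / (10800 * T) ≤
      √(∑ i, (if i ∈ Finset.univ.filter (fun i => |u i| ≤ 1 / Real.exp (12 * T))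
        then u i else 0) ^ 2) := by
  set E := Real.exp (12 * T) with hEdef
  have hEpos : 0 < E := Real.exp_pos _
  set w : ι → ℝ := fun i => if i ∈ Finset.univ.filter (fun i => |u i| ≤ 1 / E)
    then u i else 0 with hw
  have h1 : E ^ 2 - 4 / 3 * T * E ≤ ∑ i, |w i| := by
    have h2 : ∀ i, |u i| - E * u i ^ 2 ≤ |w i| := fun i => by
      simp only [hw, Finset.mem_filter, Finset.mem_univ, true_and]
      split_ifs with h
      · nlinarith [sq_nonneg (u i)]
      · rw [not_le, div_lt_iff₀ hEpos] at h
        rw [← sq_abs (u i), abs_zero]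
        nlinarith [abs_nonneg (u i)]
    calc E ^ 2 - 4 / 3 * T * E ≤ ∑ i, |u i| - E * ∑ i, u i ^ 2 := by rw [hu]; nlinarith
      _ = ∑ i, (|u i| - E * u i ^ 2) := by rw [Finset.mul_sum, Finset.sum_sub_distrib]
      _ ≤ _ := Finset.sum_le_sum fun i _ => h2 i
  have h3 : (∑ i, |w i|) ^ 2 ≤ E ^ 4 * ∑ i, w i ^ 2 := by
    have := sq_sum_le_card_mul_sum_sq (s := Finset.univ) (f := fun i => |w i|)
    simpa [hcard] using this
  refine Real.le_sqrt_of_sq_le ?_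
  have hT0 : 0 < T := by linarith
  have h4 : E ^ 2 * (1 - 1 / (10800 * T)) ≤ ∑ i, |w i| := by
    refine le_trans ?_ h1
    have : 4 / 3 * T ≤ E * (1 / (10800 * T)) := by
      rw [mul_one_div, le_div_iff₀ (by positivity)]
      nlinarith
    nlinarith
  have h5 : 0 ≤ 1 - 1 / (10800 * T) := by
    rw [sub_nonneg, div_le_one (by positivity)]
    linarith
  have h6 : (E ^ 2 * (1 - 1 / (10800 * T))) ^ 2 ≤ E ^ 4 * ∑ i, w i ^ 2 :=
    (pow_le_pow_left₀ (by positivity) h4 2).trans h3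
  refine le_of_mul_le_mul_left ?_ (show 0 < E ^ 4 by positivity)
  calc E ^ 4 * (1 - 1 / (10800 * T)) ^ 2 = (E ^ 2 * (1 - 1 / (10800 * T))) ^ 2 := by ring
    _ ≤ _ := h6

lemma exp_twelve_mul_ge {T : ℝ} (hT : 3 / 4 ≤ T) : 14400 * T ^ 2 ≤ Real.exp (12 * T) := by
  have h1 : (90 : ℝ) ≤ Real.exp 4.5 := by
    have h3 : Real.exp 4.5 ^ 2 = Real.exp 1 ^ 9 := by
      rw [← Real.exp_nat_mul, ← Real.exp_nat_mul]; norm_num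
    have h4 : (90 : ℝ) ^ 2 ≤ Real.exp 1 ^ 9 := by
      calc (90 : ℝ) ^ 2 ≤ 2.7182818283 ^ 9 := by norm_num
        _ ≤ _ := by
          have := Real.exp_one_gt_d9
          gcongr
    exact (pow_le_pow_iff_left₀ (by norm_num) (Real.exp_pos _).le (by norm_num)).1 (h4.trans h3.ge)
  have h2 : 120 * T ≤ Real.exp (6 * T) := by
    have h3 := Real.add_one_le_exp (6 * T - 4.5)
    calc 120 * T ≤ 90 * (6 * T - 4.5 + 1) := by linarith
      _ ≤ Real.exp 4.5 * Real.exp (6 * T - 4.5) := by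
          gcongr
          linarith
      _ = Real.exp (6 * T) := by rw [← Real.exp_add]; ring_nf
  calc 14400 * T ^ 2 = (120 * T) ^ 2 := by ring
    _ ≤ Real.exp (6 * T) ^ 2 := by gcongr
    _ = Real.exp (12 * T) := by rw [← Real.exp_nat_mul]; ring_nf

/-- A Rademacher sum in dimension `n = exp (48 T)` whose coefficients have `ℓ¹` norm `√n` is at least
`√T` in absolute value with probability at least `n ^ (-1/48) / 72`. -/
lemma card_abs_signSum_ge_of_exp (u : ι → ℝ) {T : ℝ} (hT : 0 < T)
    (hcard : (Fintype.card ι : ℝ) = Real.exp (12 * T) ^ 4)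
    (hu : ∑ i, |u i| = Real.exp (12 * T) ^ 2) :
    2 ^ Fintype.card ι * (Real.exp (-T) / 72) ≤
      ∑ ζ : ι → Bool, if √T ≤ |signSum u ζ| then (1 : ℝ) else 0 := by
  set E := Real.exp (12 * T) with hEdef
  have hEpos : 0 < E := Real.exp_pos _
  have hQ1 : 1 ≤ ∑ i, u i ^ 2 := by
    have h := sq_sum_le_card_mul_sum_sq (s := Finset.univ) (f := fun i => |u i|)
    simp only [hu, sq_abs, Finset.card_univ, hcard] at h
    refine le_of_mul_le_mul_left ?_ (show 0 < E ^ 4 by positivity)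
    linarith [show (E ^ 2) ^ 2 = E ^ 4 by ring]
  have hscale : ∀ (v : ι → ℝ) (c : ℝ) ζ, signSum (fun i => v i / c) ζ = signSum v ζ / c :=
    fun v c ζ => by simp only [signSum, Finset.sum_div, div_mul_eq_mul_div]
  by_cases hQ : 4 / 3 * T ≤ ∑ i, u i ^ 2
  · set Q := ∑ i, u i ^ 2 with hQdef
    have hQs : √Q ^ 2 = Q := Real.sq_sqrt (by linarith)
    have h := card_signSum_sq_ge (fun i => u i / √Q) (by
      simp only [div_pow, hQs, ← Finset.sum_div]
      exact div_self (by linarith))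
    refine le_trans ?_ (h.trans (Finset.sum_le_sum fun ζ _ => ?_))
    · have : Real.exp (-T) ≤ 1 := Real.exp_le_one_iff.2 (by linarith)
      gcongr
    · rw [hscale, div_pow, hQs]
      by_cases hc : 3 / 4 ≤ signSum u ζ ^ 2 / Q
      · rw [le_div_iff₀ (by linarith)] at hc
        have : √T ≤ |signSum u ζ| := Real.sqrt_le_iff.2 ⟨abs_nonneg _, by rw [sq_abs]; linarith⟩
        rw [if_pos this]
        split_ifs <;> norm_num
      · rw [if_neg hc]
        split_ifs <;> norm_num
  · rw [not_le] at hQ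
    have hT1 : 3 / 4 ≤ T := by linarith
    have hE := exp_twelve_mul_ge hT1
    have hσ := sqrt_sum_sq_small_ge u hT1 hcard hu hQ.le hE
    rw [← hEdef] at hσ hE
    refine le_trans ?_ (card_signSum_ge_le_card_abs u
      (Finset.univ.filter fun i => |u i| ≤ 1 / E) √T)
    set w : ι → ℝ := fun i => if i ∈ Finset.univ.filter (fun i => |u i| ≤ 1 / E)
      then u i else 0 with hw
    set σ := √(∑ i, w i ^ 2) with hσdef
    have hσ1 : 0.999 ≤ σ := by
      refine le_trans ?_ hσ
      have : 1 / (10800 * T) ≤ 0.001 := by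
        rw [div_le_iff₀ (by linarith)]
        linarith
      linarith
    have hσ2 : σ ^ 2 = ∑ i, w i ^ 2 := Real.sq_sqrt (Finset.sum_nonneg fun i _ => sq_nonneg _)
    set t := √T with ht
    have htT : t ^ 2 = T := Real.sq_sqrt hT.le
    have ht1 : 0.86 ≤ t := Real.le_sqrt_of_sq_le (by linarith)
    have ht8 : T ^ 4 = t ^ 8 := by rw [← htT]; ring
    have hsmall : ∀ i, (w i / σ) ^ 2 ≤ 0.000000005 / t ^ 8 := fun i => by
      have h1 : w i ^ 2 ≤ (1 / E) ^ 2 := by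
        refine sq_le_sq.2 ?_
        rw [abs_of_pos (show 0 < 1 / E by positivity)]
        simp only [hw, Finset.mem_filter, Finset.mem_univ, true_and]
        split_ifs with hi
        · exact hi
        · rw [abs_zero]
          positivity
      have h2 : 14400 ^ 2 * t ^ 8 ≤ E ^ 2 := by
        rw [← ht8]
        calc 14400 ^ 2 * T ^ 4 = (14400 * T ^ 2) ^ 2 := by ring
          _ ≤ E ^ 2 := by gcongr
      have h3 : 0.998 ≤ σ ^ 2 := by nlinarith
      rw [div_pow, div_le_div_iff₀ (by positivity) (by positivity)]
      have h4 : w i ^ 2 * E ^ 2 ≤ 1 := by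
        rw [one_div, inv_pow] at h1
        calc w i ^ 2 * E ^ 2 ≤ (E ^ 2)⁻¹ * E ^ 2 := by gcongr
          _ = 1 := inv_mul_cancel₀ (by positivity)
      have h5 : w i ^ 2 * (14400 ^ 2 * t ^ 8) ≤ 1 :=
        (mul_le_mul_of_nonneg_left h2 (sq_nonneg _)).trans h4
      linarith
    have hlevel : t / σ ≤ (t + 1.01) - (t + 1.01) ^ 3 * (0.000000005 / t ^ 8) / 2 - 1 := by
      have h1 : t / σ ≤ t + 0.005 := by
        rw [div_le_iff₀ (by linarith)]
        have h2 : t * (1 / (10800 * T)) ≤ 0.001 := by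
          rw [mul_one_div, div_le_iff₀ (by linarith), ← htT]
          nlinarith
        nlinarith
      have h2 : (t + 1.01) ^ 3 * (0.000000005 / t ^ 8) / 2 ≤ 0.005 := by
        have h3 : t + 1.01 ≤ 2.2 * t := by linarith
        have h4 : (0.4 : ℝ) ≤ t ^ 5 := by
          calc (0.4 : ℝ) ≤ 0.86 ^ 5 := by norm_num
            _ ≤ t ^ 5 := by gcongr
        calc (t + 1.01) ^ 3 * (0.000000005 / t ^ 8) / 2 ≤
              (2.2 * t) ^ 3 * (0.000000005 / t ^ 8) / 2 := by gcongr
          _ = 2.2 ^ 3 * 0.000000005 / 2 / t ^ 5 := by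
              have : t ≠ 0 := by linarith
              field_simp
          _ ≤ 0.005 := by
              rw [div_le_iff₀ (by linarith)]
              linarith
      linarith
    have h := card_signSum_ge_of_small (fun i => w i / σ) (by
      simp only [div_pow, hσ2, ← Finset.sum_div]
      exact div_self (by rw [← hσ2]; positivity)) hsmall (by linarith) hlevel
    simp only [hscale, div_le_div_iff_of_pos_right (show 0 < σ by linarith)] at h
    refine le_trans ?_ h
    rw [← htT]
    exact mul_le_mul_of_nonneg_left (exp_neg_div_le_tail ht1 (by positivity) le_rfl) (by positivity)

end SignSums

lemma card_abs_signSum_ge {n : ℕ} (hn : 2 ≤ n) (v : Fin n → ℝ) :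
    (2 : ℝ) ^ n * ((n : ℝ) ^ (-(1 / 48) : ℝ) / 72) ≤
      ((Finset.univ.filter fun ζ : Fin n → Bool =>
        √(Real.log n / (48 * n)) * ∑ i, |v i| ≤ |signSum v ζ|).card : ℝ) := by
  have hn0 : (0 : ℝ) < n := by positivity
  have hlog : 0 < Real.log n := Real.log_pos (by exact_mod_cast hn)
  set T := Real.log n / 48 with hT
  have hTpos : 0 < T := by positivity
  have hE4 : Real.exp (12 * T) ^ 4 = n := by
    rw [← Real.exp_nat_mul, show ((4 : ℕ) : ℝ) * (12 * T) = Real.log n by rw [hT]; push_cast; ring,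
      Real.exp_log hn0]
  have hE2 : √(n : ℝ) = Real.exp (12 * T) ^ 2 := by
    rw [← hE4, show Real.exp (12 * T) ^ 4 = (Real.exp (12 * T) ^ 2) ^ 2 by ring,
      Real.sqrt_sq (by positivity)]
  have hexp : (n : ℝ) ^ (-(1 / 48) : ℝ) = Real.exp (-T) := by
    rw [Real.rpow_def_of_pos hn0, hT]; ring_nf
  have hsq : √(Real.log n / (48 * n)) = √T / √n := by
    rw [← Real.sqrt_div hTpos.le, hT, div_div]
  rcases (Finset.sum_nonneg fun i (_ : i ∈ Finset.univ) => abs_nonneg (v i)).eq_or_lt with h0 | h0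
  · rw [← h0]
    simp only [mul_zero, abs_nonneg, Finset.filter_true, Finset.card_univ, Fintype.card_fun,
      Fintype.card_bool, Fintype.card_fin]
    push_cast
    refine mul_le_of_le_one_right (by positivity) ?_
    have : Real.exp (-T) ≤ 1 := Real.exp_le_one_iff.2 (by linarith)
    rw [hexp]; linarith
  · set A := ∑ i, |v i| with hA
    have hsn : 0 < √(n : ℝ) := Real.sqrt_pos.2 hn0
    have h := card_abs_signSum_ge_of_exp (fun i => v i * (√n / A)) hTpos (by simp [hE4]) (by
      simp only [abs_mul, ← Finset.sum_mul, ← hA, abs_of_pos (div_pos hsn h0)]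
      rw [← hE2]
      field_simp)
    have hscale : ∀ ζ, |signSum (fun i => v i * (√n / A)) ζ| = |signSum v ζ| * (√n / A) :=
      fun ζ => by
        rw [← abs_of_pos (div_pos hsn h0), ← abs_mul, abs_of_pos (div_pos hsn h0)]
        simp only [signSum, Finset.sum_mul]
        congr 1
        exact Finset.sum_congr rfl fun i _ => by ring
    rw [Finset.sum_boole] at h
    simp only [hscale, Fintype.card_fin] at h
    rw [hexp]
    have hiff : ∀ ζ : Fin n → Bool, √(Real.log n / (48 * n)) * A ≤ |signSum v ζ| ↔
        √T ≤ |signSum v ζ| * (√n / A) := fun ζ => by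
      rw [hsq, ← div_le_iff₀ (div_pos hsn h0), show √T / √n * A = √T / (√n / A) by field_simp]
    simpa only [hiff] using h

section Norm

variable {n : ℕ} {N : (Fin n → ℝ) → ℝ}

lemma continuous_of_subadditive_of_abs_homogeneous (htri : ∀ x y, N (x + y) ≤ N x + N y)
    (hhom : ∀ (c : ℝ) (x), N (c • x) = |c| * N x) : Continuous N := by
  have hconv : ConvexOn ℝ Set.univ N := by
    refine ⟨convex_univ, fun x _ y _ a b ha hb _ => ?_⟩
    refine (htri _ _).trans ?_
    rw [hhom, hhom, abs_of_nonneg ha, abs_of_nonneg hb, smul_eq_mul, smul_eq_mul]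
  exact hconv.locallyLipschitz.continuous

lemma lpNorm_top_le_one_iff (hn : 0 < n) (x : Fin n → ℝ) :
    lpNorm ∞ x ≤ 1 ↔ ∀ i, |x i| ≤ 1 := by
  have : Nonempty (Fin n) := ⟨⟨0, hn⟩⟩
  rw [lpNorm, if_pos rfl]
  exact ciSup_le_iff (Set.finite_range _).bddAbove

lemma exists_isMax_cube (hn : 0 < n) (hN : Continuous N) :
    ∃ x : Fin n → ℝ, lpNorm ∞ x ≤ 1 ∧ ∀ y : Fin n → ℝ, lpNorm ∞ y ≤ 1 → N y ≤ N x := by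
  have hset : {x : Fin n → ℝ | lpNorm ∞ x ≤ 1} = Set.univ.pi fun _ => Set.Icc (-1 : ℝ) 1 := by
    ext x
    simp only [Set.mem_ofPred_eq, lpNorm_top_le_one_iff hn, Set.mem_univ_pi, Set.mem_Icc, abs_le]
  have hcomp : IsCompact {x : Fin n → ℝ | lpNorm ∞ x ≤ 1} := by
    rw [hset]
    exact isCompact_univ_pi fun _ => isCompact_Icc
  have hne : {x : Fin n → ℝ | lpNorm ∞ x ≤ 1}.Nonempty :=
    ⟨0, by simp [lpNorm_top_le_one_iff hn]⟩
  obtain ⟨x, hx, hmax⟩ := hcomp.exists_isMaxOn hne hN.continuousOn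
  exact ⟨x, hx, fun y hy => hmax hy⟩

lemma exists_supporting_functional (htri : ∀ x y, N (x + y) ≤ N x + N y)
    (hhom : ∀ (c : ℝ) (x), N (c • x) = |c| * N x) (x₀ : Fin n → ℝ) :
    ∃ g : (Fin n → ℝ) →ₗ[ℝ] ℝ, g x₀ = N x₀ ∧ ∀ x, |g x| ≤ N x := by
  have h0 : N 0 = 0 := by simpa using hhom 0 0
  have hneg : ∀ x, N (-x) = N x := fun x => by simpa using hhom (-1) x
  have hnonneg : ∀ x, 0 ≤ N x := fun x => by
    have := htri x (-x)
    rw [add_neg_cancel, h0, hneg] at this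
    linarith
  have habs : ∀ g : (Fin n → ℝ) →ₗ[ℝ] ℝ, (∀ x, g x ≤ N x) → ∀ x, |g x| ≤ N x :=
    fun g hg x => abs_le'.2 ⟨hg x, by simpa [hneg] using hg (-x)⟩
  by_cases hx : x₀ = 0
  · exact ⟨0, by simp [hx, h0], fun x => by simpa using hnonneg x⟩
  · obtain ⟨g, hg, hgN⟩ := exists_extension_of_le_sublinear
      (LinearPMap.mkSpanSingleton (σ := RingHom.id ℝ) x₀ (N x₀) hx) N
      (fun c hc x => by rw [hhom, abs_of_pos hc]) htri (by
        rintro ⟨x, hxs⟩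
        obtain ⟨c, rfl⟩ := Submodule.mem_span_singleton.1 hxs
        rw [LinearPMap.mkSpanSingleton'_apply, hhom]
        exact mul_le_mul_of_nonneg_right (le_abs_self c) (hnonneg _))
    refine ⟨g, ?_, habs g hgN⟩
    rw [hg ⟨x₀, Submodule.mem_span_singleton_self x₀⟩]
    exact LinearPMap.mkSpanSingleton_apply ℝ ℝ hx (N x₀)

end Norm

/-- If a fraction at least `p` of the elements of `α` is good, then among `M ≥ log 2 / p`
independent uniform samples at least one is good with probability at least `1 / 2`. -/
lemma half_le_card_exists_div_card {α : Type*} [Fintype α] [DecidableEq α] (P : α → Prop)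
    [DecidablePred P] {M : ℕ} {p : ℝ}
    (hP : Fintype.card α * p ≤ ((Finset.univ.filter P).card : ℝ)) (hM : Real.log 2 ≤ M * p) :
    (1 / 2 : ℝ) * (Fintype.card (Fin M → α) : ℝ) ≤
      ((Finset.univ.filter fun f : Fin M → α => ∃ i, P (f i)).card : ℝ) := by
  have hbad : (Finset.univ.filter fun f : Fin M → α => ¬ ∃ i, P (f i)) =
      Fintype.piFinset fun _ => Finset.univ.filter fun a => ¬ P a := by
    ext f
    simp
  have h1 := Finset.card_filter_add_card_filter_not (s := (Finset.univ : Finset (Fin M → α)))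
    (fun f => ∃ i, P (f i))
  have h2 := Finset.card_filter_add_card_filter_not (s := (Finset.univ : Finset α)) P
  rw [hbad, Fintype.card_piFinset_const, Finset.card_univ] at h1
  rw [Finset.card_univ] at h2
  have h1' := congrArg (Nat.cast : ℕ → ℝ) h1
  have h2' := congrArg (Nat.cast : ℕ → ℝ) h2
  push_cast at h1' h2'
  set b : ℝ := ((Finset.univ.filter fun a => ¬ P a).card : ℝ) with hb
  have hc : (Fintype.card (Fin M → α) : ℝ) = (Fintype.card α : ℝ) ^ M := by simp
  have hb1 : b ≤ Fintype.card α * Real.exp (-p) := by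
    have := Real.add_one_le_exp (-p)
    have := mul_le_mul_of_nonneg_left this (Nat.cast_nonneg (α := ℝ) (Fintype.card α))
    linarith
  have hb2 : b ^ M ≤ (Fintype.card α : ℝ) ^ M * (1 / 2) := by
    calc b ^ M ≤ (Fintype.card α * Real.exp (-p)) ^ M := by gcongr
      _ = (Fintype.card α : ℝ) ^ M * Real.exp (-(M * p)) := by
          rw [mul_pow, ← Real.exp_nat_mul]; ring_nf
      _ ≤ (Fintype.card α : ℝ) ^ M * Real.exp (-Real.log 2) := by gcongr
      _ = _ := by rw [Real.exp_neg, Real.exp_log two_pos]; norm_num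
  rw [hc] at h1' ⊢
  linarith

/-- Randomized approximation of `D = sup{ N(x) : ‖x‖_∞ ≤ 1 }`: with
`M = ⌈72·(ln 2)·n^{1/48}⌉` independent uniform sign vectors `ζ^1,…,ζ^M ∈ {−1,1}^n`,
with probability at least `1/2` one has
`√(log n/(48 n))·D ≤ max_i N(ζ^i) ≤ D`.  The probability is expressed by counting
the (`M`-tuples of) sign patterns. -/
theorem randomized_diameter_approx_linf (n : ℕ) (hn : 2 ≤ n)
    (N : (Fin n → ℝ) → ℝ)
    (htri : ∀ x y, N (x + y) ≤ N x + N y)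
    (hhom : ∀ (c : ℝ) (x), N (c • x) = |c| * N x)
    (hdef : ∀ x, N x = 0 → x = 0) :
    let D : ℝ := sSup {v : ℝ | ∃ x : Fin n → ℝ, lpNorm ∞ x ≤ 1 ∧ N x = v}
    let M : ℕ := ⌈72 * Real.log 2 * (n : ℝ) ^ ((1 : ℝ) / 48)⌉₊
    (1 / 2 : ℝ) ≤
      ((Finset.univ.filter fun ζ : Fin M → (Fin n → Bool) =>
          Real.sqrt (Real.log n / (48 * n)) * D ≤
            (⨆ i : Fin M, N fun k => if ζ i k then 1 else -1) ∧
          (⨆ i : Fin M, N fun k => if ζ i k then 1 else -1) ≤ D).card : ℝ) /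
        (Fintype.card (Fin M → Fin n → Bool) : ℝ) := by
  intro D M
  have hn0 : 0 < n := by omega
  have hnpos : (0 : ℝ) < n := by exact_mod_cast hn0
  obtain ⟨x₀, hx₀, hmax⟩ :=
    exists_isMax_cube hn0 (continuous_of_subadditive_of_abs_homogeneous htri hhom)
  have hD : D = N x₀ := IsGreatest.csSup_eq
    ⟨⟨x₀, hx₀, rfl⟩, by rintro _ ⟨y, hy, rfl⟩; exact hmax y hy⟩
  obtain ⟨g, hg₀, hg⟩ := exists_supporting_functional htri hhom x₀
  have hM : 72 * Real.log 2 * (n : ℝ) ^ ((1 : ℝ) / 48) ≤ M := Nat.le_ceil _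
  have hlog2 : 0 < Real.log 2 := Real.log_pos one_lt_two
  have hrpow : (0 : ℝ) < (n : ℝ) ^ ((1 : ℝ) / 48) := Real.rpow_pos_of_pos hnpos _
  have hMpos : 0 < M := Nat.ceil_pos.2 (by positivity)
  have : Nonempty (Fin M) := ⟨⟨0, hMpos⟩⟩
  set v : Fin n → ℝ := fun i => g (Pi.single i 1) with hv
  have hgv : ∀ x, g x = ∑ i, v i * x i := fun x => by
    conv_lhs => rw [LinearMap.pi_apply_eq_sum_univ g x]
    refine Finset.sum_congr rfl fun i _ => ?_
    rw [smul_eq_mul, mul_comm, hv]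
    congr 2
    ext j
    simp [Pi.single_apply, eq_comm]
  have hDv : D ≤ ∑ i, |v i| := by
    rw [hD, ← hg₀, hgv]
    refine Finset.sum_le_sum fun i _ => ?_
    have h1 := (lpNorm_top_le_one_iff hn0 x₀).1 hx₀ i
    calc v i * x₀ i ≤ |v i| * |x₀ i| := (le_abs_self _).trans_eq (abs_mul _ _)
      _ ≤ |v i| := mul_le_of_le_one_right (abs_nonneg _) h1
  have hNζ : ∀ ζ : Fin n → Bool, |signSum v ζ| ≤ N fun k => if ζ k then 1 else -1 := fun ζ => by
    have h := hg fun k => if ζ k then 1 else -1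
    rwa [hgv] at h
  have hNle : ∀ ζ : Fin n → Bool, (N fun k => if ζ k then 1 else -1) ≤ D := fun ζ => by
    rw [hD]
    refine hmax _ ((lpNorm_top_le_one_iff hn0 _).2 fun k => ?_)
    split_ifs <;> simp
  have hcount := half_le_card_exists_div_card (M := M)
    (fun ζ : Fin n → Bool => √(Real.log n / (48 * n)) * ∑ i, |v i| ≤ |signSum v ζ|)
    (p := (n : ℝ) ^ (-(1 / 48) : ℝ) / 72) (by simpa using card_abs_signSum_ge hn v) (by
      rw [Real.rpow_neg hnpos.le]
      calc Real.log 2 = 72 * Real.log 2 * (n : ℝ) ^ ((1 : ℝ) / 48) *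
            (((n : ℝ) ^ ((1 : ℝ) / 48))⁻¹ / 72) := by field_simp
        _ ≤ _ := by gcongr)
  rw [le_div_iff₀ (by exact_mod_cast Fintype.card_pos)]
  refine hcount.trans ?_
  refine Nat.cast_le.2 (Finset.card_le_card fun ζ hζ => ?_)
  obtain ⟨i, hi⟩ := (Finset.mem_filter.1 hζ).2
  refine Finset.mem_filter.2 ⟨Finset.mem_univ _, ?_, ciSup_le fun j => hNle (ζ j)⟩
  calc √(Real.log n / (48 * n)) * D ≤ √(Real.log n / (48 * n)) * ∑ i, |v i| := by gcongr
    _ ≤ |signSum v (ζ i)| := hi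
    _ ≤ N fun k => if ζ i k then 1 else -1 := hNζ _
    _ ≤ _ := le_ciSup (f := fun i : Fin M => N fun k => if ζ i k then 1 else -1)
        (Set.finite_range _).bddAbove i
end
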